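/- arXiv:2205.10934 — 2 statements merged into one kernel-verified Lean document; each statement's English description precedes it below -/
import Mathlib

section
/- Let W = {w_{ij}} ∈ ℝ^{m×m} be a nonnegative doubly stochastic matrix with η := ‖W − (1/m)𝟙𝟙ᵀ‖ < 1 (spectral norm), and let each f_i : ℝ^d → ℝ be convex with L-Lipschitz continuous gradient; assume F = (1/m)∑_i f_i attains its minimum. For each k let B^k ∈ ℝ^{m×m} be a nonnegative column-stochastic matrix and Λ^k = diag(λ₁^k,…,λ_m^k) with λ_i^k ≥ 0, and let the stacked iterate x^k = (x₁^k,…,x_m^k) ∈ ℝ^{md} evolve as x^{k+1} = (W ⊗ I_d)x^k − ((B^k Λ^k) ⊗ I_d) g^k, where g^k = (∇f₁(x₁^k),…,∇f_m(x_m^k)). If every stepsize satisfies ∑_{k=0}^∞ λ_i^k = ∞ and ∑_{k=0}^∞ (λ_i^k)² < ∞, and the stepsize heterogeneity satisfies ∑_{k=0}^∞ ∑_{i≠j} |λ_i^k − λ_j^k| < ∞, then with x̄^k = (1/m)∑_i x_i^k one has lim_{k→∞} ‖x_i^k − x̄^k‖ = 0 for all i, and there exists a minimizer θ* of F with lim_{k→∞}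 ‖x̄^k − θ*‖ = 0. -/
open Filter Topology

/-- Spectral (induced Euclidean) norm of a real square matrix. -/
noncomputable def specNorm {m : ℕ} (A : Matrix (Fin m) (Fin m) ℝ) : ℝ :=
  ‖Matrix.toEuclideanCLM (𝕜 := ℝ) A‖

/-- A deterministic Robbins–Siegmund lemma with summable multiplicative perturbations. -/
lemma robbins_siegmund {w s b : ℕ → ℝ} (hw : ∀ k, 0 ≤ w k) (hs : ∀ k, 0 ≤ s k)
    (hb : ∀ k, 0 ≤ b k) (hsum : Summable s)
    (h : ∀ k, w (k + 1) + b k ≤ (1 + s k) * w k) :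
    (∃ l, Tendsto w atTop (𝓝 l)) ∧ Summable b := by
  have hexp : ∀ n, w n ≤ w 0 * Real.exp (∑ k ∈ Finset.range n, s k) := by
    intro n
    induction n with
    | zero => simp
    | succ n ih =>
      rw [Finset.sum_range_succ, Real.exp_add, ← mul_assoc]
      calc w (n + 1) ≤ (1 + s n) * w n := by linarith [h n, hb n]
        _ ≤ Real.exp (s n) * w n := by
          gcongr
          · exact hw n
          · linarith [Real.add_one_le_exp (s n)]
        _ ≤ Real.exp (s n) * (w 0 * Real.exp (∑ k ∈ Finset.range n, s k)) := by gcongr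
        _ = _ := by ring
  obtain ⟨M, hM⟩ : ∃ M, ∀ n, w n ≤ M := by
    refine ⟨w 0 * Real.exp (∑' k, s k), fun n => (hexp n).trans ?_⟩
    have := hsum.sum_le_tsum (Finset.range n) fun k _ => hs k
    gcongr
    exact hw 0
  have hM0 : 0 ≤ M := (hw 0).trans (hM 0)
  have hstep : ∀ k, w (k + 1) + b k ≤ w k + s k * M := fun k => by
    have := mul_le_mul_of_nonneg_left (hM k) (hs k)
    linarith [h k]
  have hpartial : ∀ n, w n + ∑ k ∈ Finset.range n, b k ≤
      w 0 + ∑ k ∈ Finset.range n, s k * M := by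
    intro n
    induction n with
    | zero => simp
    | succ n ih =>
      rw [Finset.sum_range_succ, Finset.sum_range_succ]
      linarith [hstep n]
  have hsM : Summable fun k => s k * M := hsum.mul_right M
  have hle : ∀ n, ∑ k ∈ Finset.range n, s k * M ≤ ∑' k, s k * M := fun n =>
    hsM.sum_le_tsum (Finset.range n) fun k _ => mul_nonneg (hs k) hM0
  refine ⟨?_, summable_of_sum_range_le (c := w 0 + ∑' k, s k * M) hb fun n => by
    linarith [hpartial n, hle n, hw n]⟩
  have hanti : Antitone fun n => w n - ∑ k ∈ Finset.range n, s k * M :=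
    antitone_nat_of_succ_le fun n => by
      rw [Finset.sum_range_succ]
      linarith [hstep n, hb n]
  have hbdd : BddBelow (Set.range fun n => w n - ∑ k ∈ Finset.range n, s k * M) :=
    ⟨-∑' k, s k * M, by
      rintro _ ⟨n, rfl⟩
      simp only
      linarith [hle n, hw n]⟩
  have hlim := (tendsto_atTop_ciInf hanti hbdd).add hsM.hasSum.tendsto_sum_nat
  exact ⟨_, by simpa using hlim⟩

/-- If `∑ μ k = ∞` and `∑ μ k * r k < ∞`, then `r` is frequently below every positive level. -/
lemma frequently_lt_of_summable_mul {μ r : ℕ → ℝ} (hμ : ∀ k, 0 ≤ μ k)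
    (hdiv : Tendsto (fun n => ∑ k ∈ Finset.range n, μ k) atTop atTop)
    (hsum : Summable fun k => μ k * r k) {ε : ℝ} (hε : 0 < ε) :
    ∃ᶠ k in atTop, r k < ε := by
  intro hev
  refine (not_summable_iff_tendsto_nat_atTop_of_nonneg hμ).2 hdiv ?_
  refine (hsum.mul_right ε⁻¹).of_norm_bounded_eventually_nat ?_
  filter_upwards [hev] with k hk
  rw [Real.norm_of_nonneg (hμ k), ← div_eq_mul_inv, le_div_iff₀ hε]
  exact mul_le_mul_of_nonneg_left (not_lt.1 hk) (hμ k)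

/-- First-order characterization of convexity, via the gradient. -/
lemma ConvexOn.sub_le_inner_gradient {E : Type*} [NormedAddCommGroup E] [InnerProductSpace ℝ E]
    [CompleteSpace E] {f : E → ℝ} (hf : ConvexOn ℝ Set.univ f) (hd : Differentiable ℝ f)
    (y θ : E) : f y - f θ ≤ inner ℝ (gradient f y) (y - θ) := by
  have hcomp : ConvexOn ℝ Set.univ (f ∘ AffineMap.lineMap (k := ℝ) y θ) := by
    simpa using hf.comp_affineMap (AffineMap.lineMap (k := ℝ) y θ)
  have hderiv : HasDerivAt (f ∘ AffineMap.lineMap (k := ℝ) y θ)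
      (inner ℝ (gradient f y) (θ - y)) 0 := by
    have h1 : HasFDerivAt f (InnerProductSpace.toDual ℝ E (gradient f y))
        (AffineMap.lineMap (k := ℝ) y θ (0 : ℝ)) := by
      simpa using (hd y).hasGradientAt.hasFDerivAt
    simpa using h1.comp_hasDerivAt (0 : ℝ)
      (AffineMap.hasDerivAt_lineMap (a := y) (b := θ) (x := (0 : ℝ)))
  have h := hcomp.le_slope_of_hasDerivAt (Set.mem_univ _) (Set.mem_univ _) one_pos hderiv
  simp only [slope_def_field, Function.comp_apply, AffineMap.lineMap_apply_one,
    AffineMap.lineMap_apply_zero, sub_zero, div_one] at h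
  rw [← neg_sub y θ, inner_neg_right] at h
  linarith

/-- The spectral norm of `A` also bounds `A ⊗ I_d`. -/
lemma sum_norm_sq_sum_smul_le_specNorm {m d : ℕ} (A : Matrix (Fin m) (Fin m) ℝ)
    (v : Fin m → EuclideanSpace ℝ (Fin d)) :
    ∑ i, ‖∑ j, A i j • v j‖ ^ 2 ≤ specNorm A ^ 2 * ∑ j, ‖v j‖ ^ 2 := by
  simp only [EuclideanSpace.real_norm_sq_eq]
  rw [Finset.sum_comm, Finset.sum_comm (f := fun j c => (v j) c ^ 2), Finset.mul_sum]
  refine Finset.sum_le_sum fun c _ => ?_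
  have h := (Matrix.toEuclideanCLM (𝕜 := ℝ) A).le_opNorm (WithLp.toLp 2 fun j => v j c)
  have h2 := pow_le_pow_left₀ (norm_nonneg _) h 2
  rw [mul_pow, EuclideanSpace.real_norm_sq_eq, EuclideanSpace.real_norm_sq_eq] at h2
  simpa [Matrix.mulVec, dotProduct, specNorm] using h2

lemma norm_sub_sq_le_div_add_div {E : Type*} [SeminormedAddCommGroup E] (p q : E) {η : ℝ}
    (h0 : 0 < η) (h1 : η < 1) : ‖p - q‖ ^ 2 ≤ ‖p‖ ^ 2 / η + ‖q‖ ^ 2 / (1 - η) := by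
  have h1' : 0 < 1 - η := by linarith
  have hle : ‖p - q‖ ^ 2 ≤ (‖p‖ + ‖q‖) ^ 2 := by gcongr; exact norm_sub_le p q
  refine hle.trans ?_
  rw [div_add_div _ _ h0.ne' h1'.ne', le_div_iff₀ (mul_pos h0 h1')]
  nlinarith [sq_nonneg ((1 - η) * ‖p‖ - η * ‖q‖)]

lemma norm_sum_smul_sq_le {ι E : Type*} [Fintype ι] [SeminormedAddCommGroup E] [NormedSpace ℝ E]
    {c l : ι → ℝ} (g : ι → E) (hc : ∀ j, |c j| ≤ l j) :
    ‖∑ j, c j • g j‖ ^ 2 ≤ (∑ j, l j ^ 2) * ∑ j, ‖g j‖ ^ 2 := by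
  have h : ‖∑ j, c j • g j‖ ≤ ∑ j, l j * ‖g j‖ := by
    refine (norm_sum_le _ _).trans (Finset.sum_le_sum fun j _ => ?_)
    rw [norm_smul, Real.norm_eq_abs]
    exact mul_le_mul_of_nonneg_right (hc j) (norm_nonneg _)
  exact (pow_le_pow_left₀ (norm_nonneg _) h 2).trans (Finset.sum_mul_sq_le_sq_mul_sq _ _ _)

/-- One step of a perturbed averaging recursion contracts the disagreement. -/
lemma sum_norm_sq_consensus_step_le {m d : ℕ} {A C : Matrix (Fin m) (Fin m) ℝ} {η : ℝ}
    (h0 : 0 < η) (h1 : η < 1) (hA : specNorm A ≤ η) {l : Fin m → ℝ} (hC : ∀ i j, |C i j| ≤ l j)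
    (e g : Fin m → EuclideanSpace ℝ (Fin d)) :
    ∑ i, ‖∑ j, A i j • e j - ∑ j, C i j • g j‖ ^ 2 ≤
      η * ∑ j, ‖e j‖ ^ 2 + m / (1 - η) * ((∑ j, l j ^ 2) * ∑ j, ‖g j‖ ^ 2) := by
  have hη : 0 < 1 - η := by linarith
  have hAe : ∑ i, ‖∑ j, A i j • e j‖ ^ 2 ≤ η ^ 2 * ∑ j, ‖e j‖ ^ 2 :=
    (sum_norm_sq_sum_smul_le_specNorm A e).trans (by
      gcongr
      exact norm_nonneg _)
  calc ∑ i, ‖∑ j, A i j • e j - ∑ j, C i j • g j‖ ^ 2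
      ≤ ∑ i, (‖∑ j, A i j • e j‖ ^ 2 / η + ((∑ j, l j ^ 2) * ∑ j, ‖g j‖ ^ 2) / (1 - η)) := by
        refine Finset.sum_le_sum fun i _ => (norm_sub_sq_le_div_add_div _ _ h0 h1).trans ?_
        gcongr
        exact norm_sum_smul_sq_le g (hC i)
    _ = (∑ i, ‖∑ j, A i j • e j‖ ^ 2) / η
          + m / (1 - η) * ((∑ j, l j ^ 2) * ∑ j, ‖g j‖ ^ 2) := by
        rw [Finset.sum_add_distrib, Finset.sum_div]
        simp
        ring
    _ ≤ _ := by
        gcongr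
        rw [div_le_iff₀ h0]
        linarith

/-- Linear growth of Lipschitz gradients, measured at the average point `y`. -/
lemma exists_sum_norm_sq_gradient_le {m d : ℕ} {L : ℝ}
    {f : Fin m → EuclideanSpace ℝ (Fin d) → ℝ}
    (hLip : ∀ i u v, ‖gradient (f i) u - gradient (f i) v‖ ≤ L * ‖u - v‖)
    (θ : EuclideanSpace ℝ (Fin d)) :
    ∃ C, 0 ≤ C ∧ ∀ (x : Fin m → EuclideanSpace ℝ (Fin d)) (y : EuclideanSpace ℝ (Fin d)),
      ∑ j, ‖gradient (f j) (x j)‖ ^ 2 ≤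
        C * (‖y - θ‖ ^ 2 + ∑ j, ‖x j - y‖ ^ 2 + 1) := by
  set c := ∑ j, ‖gradient (f j) θ‖ ^ 2 with hc
  have hc0 : 0 ≤ c := Finset.sum_nonneg fun j _ => sq_nonneg _
  clear_value c
  refine ⟨3 * L ^ 2 + 3 * m * L ^ 2 + 3 * c, by positivity, fun x y => ?_⟩
  have hj : ∀ j, ‖gradient (f j) (x j)‖ ^ 2 ≤
      3 * L ^ 2 * ‖x j - y‖ ^ 2 + 3 * L ^ 2 * ‖y - θ‖ ^ 2 + 3 * ‖gradient (f j) θ‖ ^ 2 := by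
    intro j
    have hle : ‖gradient (f j) (x j)‖ ≤
        L * ‖x j - y‖ + L * ‖y - θ‖ + ‖gradient (f j) θ‖ := by
      have hsplit : gradient (f j) (x j) = (gradient (f j) (x j) - gradient (f j) y)
          + (gradient (f j) y - gradient (f j) θ) + gradient (f j) θ := by abel
      rw [hsplit]
      refine norm_add₃_le.trans ?_
      gcongr <;> exact hLip _ _ _
    refine (pow_le_pow_left₀ (norm_nonneg _) hle 2).trans ?_
    nlinarith [sq_nonneg (L * ‖x j - y‖ - L * ‖y - θ‖),
      sq_nonneg (L * ‖x j - y‖ - ‖gradient (f j) θ‖),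
      sq_nonneg (L * ‖y - θ‖ - ‖gradient (f j) θ‖)]
  refine (Finset.sum_le_sum fun j _ => hj j).trans ?_
  simp only [Finset.sum_add_distrib, ← Finset.mul_sum, Finset.sum_const, Finset.card_univ,
    Fintype.card_fin, nsmul_eq_mul]
  rw [← hc]
  have : 0 ≤ 3 * L ^ 2 * (‖y - θ‖ ^ 2 + 1) + 3 * m * L ^ 2 * (∑ j, ‖x j - y‖ ^ 2 + 1)
    + 3 * c * (‖y - θ‖ ^ 2 + ∑ j, ‖x j - y‖ ^ 2) := by positivity
  linarith

/-- Descent of the squared distance from the average to an arbitrary point `θ`. -/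
lemma norm_sq_average_step_le {m d : ℕ} (hm : 0 < m) {L : ℝ}
    {f : Fin m → EuclideanSpace ℝ (Fin d) → ℝ}
    (hconv : ∀ i, ConvexOn ℝ Set.univ (f i)) (hdiff : ∀ i, Differentiable ℝ (f i))
    {δ : ℝ} (hδ : 0 < δ) {l : Fin m → ℝ} (hl : ∀ j, 0 ≤ l j) (i₀ : Fin m)
    {x g : Fin m → EuclideanSpace ℝ (Fin d)} (y θ : EuclideanSpace ℝ (Fin d))
    (hg : ∀ j, ‖gradient (f j) y - g j‖ ≤ L * ‖y - x j‖) :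
    ‖y - (1 / (m : ℝ)) • ∑ j, l j • g j - θ‖ ^ 2 ≤
      ‖y - θ‖ ^ 2 - 2 * (l i₀ * ((1 / (m : ℝ)) * ∑ j, (f j y - f j θ)))
      + δ * ∑ j, ‖x j - y‖ ^ 2
      + m * (L ^ 2 / δ) * (∑ j, l j ^ 2) * ‖y - θ‖ ^ 2
      + (∑ j, |l j - l i₀|) * (∑ j, ‖g j‖ ^ 2 + m * ‖y - θ‖ ^ 2)
      + (∑ j, l j ^ 2) * ∑ j, ‖g j‖ ^ 2 := by
  set S := ∑ j, l j ^ 2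
  set D := ∑ j, |l j - l i₀|
  set a := ‖y - θ‖ with ha
  have hm1 : (1 : ℝ) ≤ m := by exact_mod_cast hm
  have hinv0 : (0 : ℝ) ≤ 1 / m := by positivity
  have hinv1 : 1 / (m : ℝ) ≤ 1 := by rw [div_le_one (by linarith)]; exact hm1
  have hS : l i₀ ^ 2 ≤ S :=
    Finset.single_le_sum (f := fun j => l j ^ 2) (fun j _ => sq_nonneg _) (Finset.mem_univ i₀)
  have hD : ∀ j, |l j - l i₀| ≤ D := fun j =>
    Finset.single_le_sum (f := fun j => |l j - l i₀|) (fun j _ => abs_nonneg _)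
      (Finset.mem_univ j)
  have hsq : ‖(1 / (m : ℝ)) • ∑ j, l j • g j‖ ^ 2 ≤ S * ∑ j, ‖g j‖ ^ 2 := by
    refine le_trans ?_ (norm_sum_smul_sq_le g fun j => (abs_of_nonneg (hl j)).le)
    rw [norm_smul, Real.norm_of_nonneg hinv0]
    gcongr
    exact mul_le_of_le_one_left (norm_nonneg _) hinv1
  have hexpand : ‖y - (1 / (m : ℝ)) • ∑ j, l j • g j - θ‖ ^ 2 =
      a ^ 2 - 2 * ((1 / (m : ℝ)) * ∑ j, l j * inner ℝ (g j) (y - θ))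
        + ‖(1 / (m : ℝ)) • ∑ j, l j • g j‖ ^ 2 := by
    rw [ha, sub_right_comm, norm_sub_sq_real, real_inner_comm, real_inner_smul_left, sum_inner]
    simp only [real_inner_smul_left]
  have hS0 : 0 ≤ S := (sq_nonneg _).trans hS
  have hD0 : 0 ≤ D := (abs_nonneg _).trans (hD i₀)
  clear_value S D a
  have hterm : ∀ j, 2 * (l i₀ * (f j y - f j θ)) - (δ * ‖x j - y‖ ^ 2 + L ^ 2 / δ * S * a ^ 2
      + D * (‖g j‖ ^ 2 + a ^ 2)) ≤ 2 * (l j * inner ℝ (g j) (y - θ)) := by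
    intro j
    have h1 : f j y - f j θ - L * ‖x j - y‖ * a ≤ inner ℝ (g j) (y - θ) := by
      have hc := (hconv j).sub_le_inner_gradient (hdiff j) y θ
      have hcs := real_inner_le_norm (gradient (f j) y - g j) (y - θ)
      rw [inner_sub_left] at hcs
      have hlip : ‖gradient (f j) y - g j‖ * ‖y - θ‖ ≤ L * ‖x j - y‖ * a := by
        rw [norm_sub_rev (x j) y, ha]
        gcongr
        exact hg j
      linarith
    have h2 : 2 * (l i₀ * (L * ‖x j - y‖ * a)) ≤
        δ * ‖x j - y‖ ^ 2 + L ^ 2 / δ * S * a ^ 2 := by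
      have h3 : 2 * (l i₀ * (L * ‖x j - y‖ * a)) ≤
          δ * ‖x j - y‖ ^ 2 + L ^ 2 / δ * l i₀ ^ 2 * a ^ 2 := by
        have hsq : 0 ≤ (δ * ‖x j - y‖ - L * l i₀ * a) ^ 2 / δ := by positivity
        have heq : (δ * ‖x j - y‖ - L * l i₀ * a) ^ 2 / δ =
            δ * ‖x j - y‖ ^ 2 + L ^ 2 / δ * l i₀ ^ 2 * a ^ 2
              - 2 * (l i₀ * (L * ‖x j - y‖ * a)) := by
          field_simp
          ring
        linarith
      have : L ^ 2 / δ * l i₀ ^ 2 * a ^ 2 ≤ L ^ 2 / δ * S * a ^ 2 := by gcongr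
      linarith
    have h4 : -(D * (‖g j‖ ^ 2 + a ^ 2)) ≤ 2 * ((l j - l i₀) * inner ℝ (g j) (y - θ)) := by
      have habs : |(l j - l i₀) * inner ℝ (g j) (y - θ)| ≤ D * (‖g j‖ * a) := by
        rw [abs_mul, ha]
        exact mul_le_mul (hD j) (abs_real_inner_le_norm _ _) (abs_nonneg _)
          hD0
      have := mul_le_mul_of_nonneg_left (two_mul_le_add_sq ‖g j‖ a) hD0
      linarith [(abs_le.1 habs).1]
    have h5 := mul_le_mul_of_nonneg_left h1 (hl i₀)
    linarith
  have hsum := Finset.sum_le_sum fun j (_ : j ∈ Finset.univ) => hterm j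
  simp only [Finset.sum_sub_distrib, Finset.sum_add_distrib, ← Finset.mul_sum, Finset.sum_const,
    Finset.card_univ, Fintype.card_fin, nsmul_eq_mul] at hsum
  have hR0 : 0 ≤ δ * ∑ j, ‖x j - y‖ ^ 2 + m * (L ^ 2 / δ * S * a ^ 2)
      + D * (∑ j, ‖g j‖ ^ 2 + m * a ^ 2) := by
    have he : 0 ≤ ∑ j, ‖x j - y‖ ^ 2 := Finset.sum_nonneg fun j _ => sq_nonneg _
    have hG : 0 ≤ ∑ j, ‖g j‖ ^ 2 := Finset.sum_nonneg fun j _ => sq_nonneg _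
    generalize ∑ j, ‖x j - y‖ ^ 2 = e2 at he ⊢
    generalize ∑ j, ‖g j‖ ^ 2 = G2 at hG ⊢
    positivity
  have hR := mul_le_mul_of_nonneg_right hinv1 hR0
  have hsum' := mul_le_mul_of_nonneg_left hsum hinv0
  rw [hexpand]
  simp only [Finset.sum_sub_distrib]
  linarith

/-- Theorem 1: convergence of PDG-DS under diminishing uncoordinated stepsizes. -/
theorem stmt_1 {d m : ℕ} (hm : 0 < m)
    (W : Matrix (Fin m) (Fin m) ℝ)
    (hWnn : ∀ i j, 0 ≤ W i j)
    (hWrow : ∀ i, ∑ j, W i j = 1)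
    (hWcol : ∀ j, ∑ i, W i j = 1)
    (hη : specNorm (W - Matrix.of fun _ _ => (1 : ℝ) / m) < 1)
    (L : ℝ) (hL : 0 < L)
    (f : Fin m → EuclideanSpace ℝ (Fin d) → ℝ)
    (hconv : ∀ i, ConvexOn ℝ Set.univ (f i))
    (hdiff : ∀ i, Differentiable ℝ (f i))
    (hLip : ∀ i u v, ‖gradient (f i) u - gradient (f i) v‖ ≤ L * ‖u - v‖)
    (F : EuclideanSpace ℝ (Fin d) → ℝ)
    (hF : ∀ θ, F θ = (1 / (m : ℝ)) * ∑ i, f i θ)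
    (hmin : ∃ θs, ∀ y, F θs ≤ F y)
    (B : ℕ → Matrix (Fin m) (Fin m) ℝ)
    (hBnn : ∀ k i j, 0 ≤ B k i j)
    (hBcol : ∀ k j, ∑ i, B k i j = 1)
    (lam : ℕ → Fin m → ℝ)
    (hlam0 : ∀ k i, 0 ≤ lam k i)
    (x : ℕ → Fin m → EuclideanSpace ℝ (Fin d))
    (hupd : ∀ k i, x (k + 1) i =
      (∑ j, W i j • x k j) - ∑ j, (B k i j * lam k j) • gradient (f j) (x k j))
    (hdiv : ∀ i, Tendsto (fun n => ∑ k ∈ Finset.range n, lam k i) atTop atTop)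
    (hsq : ∀ i, Summable (fun k => (lam k i) ^ 2))
    (hhet : Summable (fun k => ∑ p ∈ Finset.univ.offDiag (α := Fin m), |lam k p.1 - lam k p.2|))
    (xbar : ℕ → EuclideanSpace ℝ (Fin d))
    (hxbar : ∀ k, xbar k = (1 / (m : ℝ)) • ∑ i, x k i) :
    (∀ i, Tendsto (fun k => ‖x k i - xbar k‖) atTop (𝓝 0)) ∧
      ∃ θs, (∀ y, F θs ≤ F y) ∧ Tendsto (fun k => ‖xbar k - θs‖) atTop (𝓝 0) := by
  set i₀ : Fin m := ⟨0, hm⟩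
  have hm0 : (m : ℝ) ≠ 0 := by exact_mod_cast hm.ne'
  have hm1 : (1 : ℝ) ≤ m := by exact_mod_cast hm
  set A := W - Matrix.of fun _ _ => (1 : ℝ) / m with hAdef
  obtain ⟨η, hAη, hη1⟩ := exists_between hη
  have hη0 : 0 < η := (norm_nonneg _).trans_lt hAη
  set e2 : ℕ → ℝ := fun k => ∑ j, ‖x k j - xbar k‖ ^ 2
  have he2nn : ∀ k, 0 ≤ e2 k := fun k => Finset.sum_nonneg fun j _ => sq_nonneg _
  set S : ℕ → ℝ := fun k => ∑ j, lam k j ^ 2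
  set D : ℕ → ℝ := fun k => ∑ j, |lam k j - lam k i₀|
  have hSnn : ∀ k, 0 ≤ S k := fun k => Finset.sum_nonneg fun j _ => sq_nonneg _
  have hDnn : ∀ k, 0 ≤ D k := fun k => Finset.sum_nonneg fun j _ => abs_nonneg _
  have hSsum : Summable S := summable_sum fun j _ => hsq j
  have hDsum : Summable D := by
    refine summable_sum fun j _ =>
      Summable.of_nonneg_of_le (fun k => abs_nonneg _) (fun k => ?_) hhet
    by_cases hj : j = i₀
    · rw [hj, sub_self, abs_zero]
      exact Finset.sum_nonneg fun p _ => abs_nonneg _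
    · exact Finset.single_le_sum (f := fun p : Fin m × Fin m => |lam k p.1 - lam k p.2|)
        (a := (j, i₀)) (fun p _ => abs_nonneg _) (by simpa [Finset.mem_offDiag] using hj)
  have hbar : ∀ k, xbar (k + 1) =
      xbar k - (1 / (m : ℝ)) • ∑ j, lam k j • gradient (f j) (x k j) := by
    intro k
    rw [hxbar, hxbar, ← smul_sub]
    congr 1
    simp only [hupd, Finset.sum_sub_distrib]
    congr 1
    · rw [Finset.sum_comm]
      simp only [← Finset.sum_smul, hWcol, one_smul]
    · rw [Finset.sum_comm]
      simp only [← Finset.sum_smul, ← Finset.sum_mul, hBcol, one_mul]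
  have hdev : ∀ k i, x (k + 1) i - xbar (k + 1) = ∑ j, A i j • (x k j - xbar k)
      - ∑ j, ((B k i j - 1 / m) * lam k j) • gradient (f j) (x k j) := by
    intro k i
    have h1 : ∑ j, A i j • (x k j - xbar k) = ∑ j, W i j • x k j - xbar k := by
      simp only [hAdef, Matrix.sub_apply, Matrix.of_apply, sub_smul, smul_sub,
        Finset.sum_sub_distrib, ← Finset.smul_sum, ← Finset.sum_smul, hWrow, one_smul]
      rw [← hxbar k, Finset.sum_const, Finset.card_univ, Fintype.card_fin,
        ← Nat.cast_smul_eq_nsmul ℝ, smul_smul, one_div_mul_cancel hm0, one_smul]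
      abel
    rw [h1, hbar, hupd]
    simp only [sub_mul, sub_smul, Finset.sum_sub_distrib, mul_smul, Finset.smul_sum]
    abel
  have hcoef : ∀ k i j, |(B k i j - 1 / m) * lam k j| ≤ lam k j := by
    intro k i j
    rw [abs_mul, abs_of_nonneg (hlam0 k j)]
    refine mul_le_of_le_one_left (hlam0 k j) ?_
    have hB1 : B k i j ≤ 1 := by
      rw [← hBcol k j]
      exact Finset.single_le_sum (f := fun i => B k i j) (fun i _ => hBnn k i j)
        (Finset.mem_univ i)
    have hinv0 : (0 : ℝ) ≤ 1 / m := by positivity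
    have hinv1 : 1 / (m : ℝ) ≤ 1 := by rw [div_le_one (by linarith)]; exact hm1
    rw [abs_le]
    constructor <;> linarith [hBnn k i j]
  have hgap : ∀ y θ, (1 / (m : ℝ)) * ∑ j, (f j y - f j θ) = F y - F θ := fun y θ => by
    rw [hF, hF, Finset.sum_sub_distrib, mul_sub]
  have hFcont : Continuous F := by
    rw [funext hF]
    exact continuous_const.mul (continuous_finsetSum _ fun i _ => (hdiff i).continuous)
  have lyapunov : ∀ θ, ∃ K, 0 ≤ K ∧ ∀ k,
      ‖xbar (k + 1) - θ‖ ^ 2 + e2 (k + 1)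
        + ((1 - η) / 2 * e2 k + 2 * (lam k i₀ * (F (xbar k) - F θ))) ≤
      ‖xbar k - θ‖ ^ 2 + e2 k + K * (S k + D k) * (‖xbar k - θ‖ ^ 2 + e2 k + 1) := by
    intro θ
    obtain ⟨C, hC0, hC⟩ := exists_sum_norm_sq_gradient_le hLip θ
    have hδ : 0 < (1 - η) / 2 := by linarith
    have hη' : 0 < 1 - η := by linarith
    refine ⟨m * (L ^ 2 / ((1 - η) / 2)) + (C + m) + C + m / (1 - η) * C, by positivity,
      fun k => ?_⟩
    have h1 := norm_sq_average_step_le hm hconv hdiff hδ (hlam0 k) i₀ (xbar k) θ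
      fun j => hLip j (xbar k) (x k j)
    rw [← hbar, hgap] at h1
    have h2 := sum_norm_sq_consensus_step_le (C := .of fun i j => (B k i j - 1 / m) * lam k j)
      hη0 hη1 hAη.le (hcoef k) (fun j => x k j - xbar k) fun j => gradient (f j) (x k j)
    simp only [Matrix.of_apply, ← hdev] at h2
    have hG := hC (x k) (xbar k)
    have ha0 : 0 ≤ ‖xbar k - θ‖ ^ 2 := sq_nonneg _
    change _ ≤ _ - 2 * _ + _ * e2 k + _ * S k * _ + D k * _ + S k * _ at h1
    change e2 (k + 1) ≤ _ * e2 k + _ * (S k * _) at h2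
    change _ ≤ C * (_ + e2 k + 1) at hG
    generalize ∑ j, ‖gradient (f j) (x k j)‖ ^ 2 = G at h1 h2 hG
    generalize ‖xbar k - θ‖ ^ 2 = a at h1 hG ha0 ⊢
    set U := a + e2 k + 1 with hU
    have haU : a ≤ U := by linarith [he2nn k]
    have hU0 : 0 ≤ U := ha0.trans haU
    have hSk := hSnn k
    have hDk := hDnn k
    have hSG : S k * G ≤ S k * (C * U) := mul_le_mul_of_nonneg_left hG hSk
    have hSa : m * (L ^ 2 / ((1 - η) / 2)) * S k * a ≤ m * (L ^ 2 / ((1 - η) / 2)) * S k * U := by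
      gcongr
    have hDG : D k * (G + m * a) ≤ D k * (C * U + m * U) := by gcongr
    have hSG' : m / (1 - η) * (S k * G) ≤ m / (1 - η) * (S k * (C * U)) := by gcongr
    have hrest : 0 ≤ (m * (L ^ 2 / ((1 - η) / 2)) + C + m / (1 - η) * C) * D k * U
        + (C + m) * S k * U := by positivity
    linarith
  have convergence : ∀ θ, (∀ y, F θ ≤ F y) →
      (∃ l, Tendsto (fun k => ‖xbar k - θ‖ ^ 2 + e2 k) atTop (𝓝 l)) ∧
      Summable fun k => (1 - η) / 2 * e2 k + 2 * (lam k i₀ * (F (xbar k) - F θ)) := by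
    intro θ hθ
    obtain ⟨K, hK0, hK⟩ := lyapunov θ
    obtain ⟨⟨l, hl⟩, hsum⟩ := robbins_siegmund (w := fun k => ‖xbar k - θ‖ ^ 2 + e2 k + 1)
      (s := fun k => K * (S k + D k))
      (b := fun k => (1 - η) / 2 * e2 k + 2 * (lam k i₀ * (F (xbar k) - F θ)))
      (fun k => by linarith [sq_nonneg ‖xbar k - θ‖, he2nn k])
      (fun k => mul_nonneg hK0 (add_nonneg (hSnn k) (hDnn k)))
      (fun k => add_nonneg (mul_nonneg (by linarith) (he2nn k))
        (mul_nonneg two_pos.le (mul_nonneg (hlam0 k i₀) (sub_nonneg.2 (hθ _)))))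
      ((hSsum.add hDsum).mul_left K) (fun k => by linarith [hK k])
    exact ⟨⟨l - 1, by simpa using hl.sub_const 1⟩, hsum⟩
  obtain ⟨θ₀, hθ₀⟩ := hmin
  obtain ⟨⟨l₀, hl₀⟩, hsum₀⟩ := convergence θ₀ hθ₀
  have hgapnn : ∀ k, 0 ≤ lam k i₀ * (F (xbar k) - F θ₀) := fun k =>
    mul_nonneg (hlam0 k i₀) (sub_nonneg.2 (hθ₀ _))
  have he2lim : Tendsto e2 atTop (𝓝 0) := by
    have hsum : Summable fun k => (1 - η) / 2 * e2 k :=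
      Summable.of_nonneg_of_le (fun k => mul_nonneg (by linarith) (he2nn k))
        (fun k => by linarith [hgapnn k]) hsum₀
    exact ((summable_mul_left_iff (by linarith)).1 hsum).tendsto_atTop_zero
  refine ⟨fun i => ?_, ?_⟩
  · have hsq0 : Tendsto (fun k => ‖x k i - xbar k‖ ^ 2) atTop (𝓝 0) :=
      squeeze_zero (fun k => sq_nonneg _) (fun k =>
        Finset.single_le_sum (f := fun j => ‖x k j - xbar k‖ ^ 2) (fun j _ => sq_nonneg _)
          (Finset.mem_univ i)) he2lim
    simpa using hsq0.sqrt
  have hgapsum : Summable fun k => lam k i₀ * (F (xbar k) - F θ₀) :=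
    Summable.of_nonneg_of_le hgapnn
      (fun k => by
        have : 0 ≤ (1 - η) / 2 * e2 k := mul_nonneg (by linarith) (he2nn k)
        linarith [hgapnn k]) hsum₀
  obtain ⟨φ, hφ, hφlt⟩ := extraction_forall_of_frequently fun n : ℕ =>
    frequently_lt_of_summable_mul (fun k => hlam0 k i₀) (hdiv i₀) hgapsum
      (Nat.one_div_pos_of_nat (α := ℝ) (n := n))
  have hFlim : Tendsto (fun n => F (xbar (φ n))) atTop (𝓝 (F θ₀)) := by
    rw [← tendsto_sub_nhds_zero_iff]
    exact squeeze_zero (fun n => sub_nonneg.2 (hθ₀ _)) (fun n => (hφlt n).le)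
      tendsto_one_div_add_atTop_nhds_zero_nat
  obtain ⟨M, hM⟩ := hl₀.bddAbove_range
  have hbdd : ∀ k, xbar k ∈ Metric.closedBall θ₀ √M := fun k => by
    rw [mem_closedBall_iff_norm]
    refine Real.le_sqrt_of_sq_le ?_
    have := hM ⟨k, rfl⟩
    simp only at this
    linarith [he2nn k]
  obtain ⟨θs, -, ψ, hψ, hψlim⟩ := tendsto_subseq_of_bounded Metric.isBounded_closedBall
    fun n => hbdd (φ n)
  have hFθs : F θs = F θ₀ :=
    tendsto_nhds_unique ((hFcont.tendsto θs).comp hψlim) (hFlim.comp hψ.tendsto_atTop)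
  have hθs : ∀ y, F θs ≤ F y := fun y => hFθs.trans_le (hθ₀ y)
  refine ⟨θs, hθs, ?_⟩
  obtain ⟨⟨l, hl⟩, -⟩ := convergence θs hθs
  have hsub := hl.comp (hφ.comp hψ).tendsto_atTop
  have hsub0 : Tendsto ((fun k => ‖xbar k - θs‖ ^ 2 + e2 k) ∘ φ ∘ ψ) atTop (𝓝 0) := by
    have h1 := (tendsto_iff_norm_sub_tendsto_zero.1 hψlim).pow 2
    simpa [Function.comp_def] using h1.add (he2lim.comp (hφ.comp hψ).tendsto_atTop)
  rw [tendsto_nhds_unique hsub hsub0] at hl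
  simpa using (hl.sub he2lim).sqrt
end

section
/- Let W ∈ ℝ^{m×m} be nonnegative doubly stochastic with η := ‖W − (1/m)𝟙𝟙ᵀ‖ < 1 and set r := ‖W − I‖. Let each f_i : ℝ^d → ℝ be convex with L-Lipschitz gradient and let F = (1/m)∑_i f_i attain its minimum at θ*. Let B^k be nonnegative column-stochastic matrices, Λ^k = diag(λ₁^k,…,λ_m^k) with λ_i^k ≥ 0, λ^k := (λ₁^k,…,λ_m^k), λ̄^k := (1/m)∑_i λ_i^k, λ_max^k := max_i λ_i^k. Let the stacked iterates satisfy x^1 = (W ⊗ I_d)x^0 − (Λ^0 ⊗ I_d)g^0 and x^{k+2} = 2(W ⊗ I_d)x^{k+1} − (W² ⊗ I_d)x^k − ((B^k Λ^{k+1}) ⊗ I_d) g^{k+1} + ((B^k Λ^k) ⊗ I_d) g^k, where g_i^k = ∇f_i(x_i^k), and define y^k := (W ⊗ I_d)x^k − x^{k+1}. Suppose there exist T ≥ 0 and δ, c ∈ (0,1) such that for all k ≥ T: ∑_{k=T}^∞ λ̄^k = ∞, ∑_{k=T}^∞ ‖λ^{k+1} − λ^k‖² < ∞, ∑_{k=T}^∞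 ‖λ^k − λ̄^k 𝟙‖²/λ̄^k < ∞, (2L/(m λ̄^k))(λ_max^k)² ≤ 1 − η, λ̄^k L ≤ δ/(1+δ), η + (6m²L²/(1−η))‖λ^{k+1}‖² ≤ c, and max{m³r², m²}·6L²‖λ^{k+1}‖² ≤ (1−η)³(1−c)(1−δ). Then lim_{k→∞} F(x̄^k) exists and lim_{k→∞} ‖ȳ^k‖ = lim_{k→∞} ‖x_i^k − x̄^k‖ = lim_{k→∞} ‖y_i^k − ȳ^k‖ = 0 for all i; if moreover lim_{k→∞} λ̄^k exists and is positive, then lim_{k→∞} ‖∇F(x̄^k)‖ = 0, and if {x̄^k} is bounded every accumulation point of {x̄^k} is a minimizer of F and lim_{k→∞} F(x_i^k) = F(θ*) for all i. -/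
open Filter Topology

/-- The all-ones vector in `EuclideanSpace ℝ (Fin m)`. -/
noncomputable def onesE (m : ℕ) : EuclideanSpace ℝ (Fin m) :=
  (WithLp.equiv 2 (Fin m → ℝ)).symm fun _ => 1

section SmoothConvex

variable {E : Type*} [NormedAddCommGroup E] [InnerProductSpace ℝ E] [CompleteSpace E]
  {f : E → ℝ} {g : E → E} {L : ℝ}

theorem HasGradientAt.hasDerivAt_add_smul {a : E} (u v : E) (t : ℝ)
    (h : HasGradientAt f a (u + t • v)) :
    HasDerivAt (fun s : ℝ => f (u + s • v)) (inner ℝ a v) t := by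
  have hline : HasDerivAt (fun s : ℝ => u + s • v) v t := by
    simpa using ((hasDerivAt_id t).smul_const v).const_add u
  simpa [Function.comp_def] using h.hasFDerivAt.comp_hasDerivAt t hline

theorem le_quadratic_of_lipschitz_gradient (hg : ∀ u, HasGradientAt f (g u) u)
    (hLip : ∀ u v, ‖g u - g v‖ ≤ L * ‖u - v‖) (u v : E) :
    f v ≤ f u + inner ℝ (g u) (v - u) + L / 2 * ‖v - u‖ ^ 2 := by
  set w := v - u with hw
  have hφ (t : ℝ) := (hg (u + t • w)).hasDerivAt_add_smul u w t
  have hB (t : ℝ) : HasDerivAt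
      (fun s : ℝ => f u + s * inner ℝ (g u) w + s ^ 2 * (L / 2 * ‖w‖ ^ 2))
      (inner ℝ (g u) w + t * (L * ‖w‖ ^ 2)) t := by
    have h := (((hasDerivAt_id t).mul_const (inner ℝ (g u) w)).const_add (f u)).add
      (((hasDerivAt_id t).pow 2).mul_const (L / 2 * ‖w‖ ^ 2))
    exact h.congr_deriv (by simp; ring)
  have key := image_le_of_deriv_right_le_deriv_boundary (a := 0) (b := 1)
    (fun t _ => (hφ t).continuousAt.continuousWithinAt) (fun t _ => (hφ t).hasDerivWithinAt)
    (by simp) (fun t _ => (hB t).continuousAt.continuousWithinAt)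
    (fun t _ => (hB t).hasDerivWithinAt) (fun t ht => by
      have h1 := real_inner_le_norm (g (u + t • w) - g u) w
      have h2 := hLip (u + t • w) u
      rw [add_sub_cancel_left, norm_smul, Real.norm_of_nonneg ht.1] at h2
      rw [inner_sub_left] at h1
      nlinarith [mul_le_mul_of_nonneg_right h2 (norm_nonneg w)])
    (Set.right_mem_Icc.2 zero_le_one)
  simpa [hw] using key

theorem ConvexOn.add_inner_gradient_le (hf : ConvexOn ℝ Set.univ f) {a u : E}
    (hg : HasGradientAt f a u) (v : E) : f u + inner ℝ a (v - u) ≤ f v := by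
  have hline : ConvexOn ℝ Set.univ (fun s : ℝ => f (u + s • (v - u))) := by
    have := hf.comp_affineMap (AffineMap.lineMap u v : ℝ →ᵃ[ℝ] E)
    simpa [Function.comp_def, AffineMap.lineMap_apply, add_comm] using this
  have hd : HasDerivAt (fun s : ℝ => f (u + s • (v - u))) (inner ℝ a (v - u)) 0 :=
    HasGradientAt.hasDerivAt_add_smul u (v - u) 0 (by simpa using hg)
  have := hline.le_slope_of_hasDerivAt (Set.mem_univ 0) (Set.mem_univ 1) zero_lt_one hd
  simp [slope_def_field] at this
  linarith

theorem ConvexOn.norm_gradient_sub_sq_le (hL : 0 < L) (hf : ConvexOn ℝ Set.univ f)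
    (hg : ∀ u, HasGradientAt f (g u) u) (hLip : ∀ u v, ‖g u - g v‖ ≤ L * ‖u - v‖) (u v : E) :
    ‖g u - g v‖ ^ 2 ≤ 2 * L * (f u - f v - inner ℝ (g v) (u - v)) := by
  set p := g u - g v with hp
  have h1 := hf.add_inner_gradient_le (hg v) (u - L⁻¹ • p)
  have h2 := le_quadratic_of_lipschitz_gradient hg hLip u (u - L⁻¹ • p)
  have e1 : u - L⁻¹ • p - v = (u - v) - L⁻¹ • p := by abel
  have e2 : u - L⁻¹ • p - u = -(L⁻¹ • p) := by abel
  have e3 : inner ℝ (g u) p - inner ℝ (g v) p = ‖p‖ ^ 2 := by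
    rw [← inner_sub_left, real_inner_self_eq_norm_sq]
  rw [e1, inner_sub_right, inner_smul_right] at h1
  rw [e2, inner_neg_right, inner_smul_right, norm_neg, norm_smul, Real.norm_of_nonneg
    (inv_nonneg.2 hL.le), mul_pow] at h2
  have e4 : L / 2 * (L⁻¹ ^ 2 * ‖p‖ ^ 2) = L⁻¹ / 2 * ‖p‖ ^ 2 := by field_simp
  have e5 : L⁻¹ / 2 * ‖p‖ ^ 2 ≤ f u - f v - inner ℝ (g v) (u - v) := by
    have : L⁻¹ * inner ℝ (g u) p = L⁻¹ * inner ℝ (g v) p + L⁻¹ * ‖p‖ ^ 2 := by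
      rw [← e3]; ring
    linarith
  calc ‖p‖ ^ 2 = 2 * L * (L⁻¹ / 2 * ‖p‖ ^ 2) := by field_simp
    _ ≤ _ := by gcongr

theorem inexact_gradient_step_le (hg : ∀ u, HasGradientAt f (g u) u)
    (hLip : ∀ u v, ‖g u - g v‖ ≤ L * ‖u - v‖) {s δ : ℝ} (hs : 0 < s) (hδ : 0 < δ)
    (hsL : s * L ≤ δ / (1 + δ)) (u p : E) :
    f (u - p) ≤ f u - s / 2 * ‖g u‖ ^ 2 - L / (2 * δ) * ‖p‖ ^ 2
      + ‖p - s • g u‖ ^ 2 / (2 * s) := by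
  have h := le_quadratic_of_lipschitz_gradient hg hLip u (u - p)
  rw [sub_sub_cancel_left, inner_neg_right, norm_neg] at h
  have e : ‖p - s • g u‖ ^ 2 / (2 * s)
      = ‖p‖ ^ 2 / (2 * s) - inner ℝ (g u) p + s / 2 * ‖g u‖ ^ 2 := by
    rw [norm_sub_sq_real, inner_smul_right, norm_smul, mul_pow, Real.norm_eq_abs, sq_abs,
      real_inner_comm]
    field_simp
  have hcoef : L / 2 + L / (2 * δ) ≤ 1 / (2 * s) := by
    rw [le_div_iff₀ (by positivity)]
    rw [le_div_iff₀ (by positivity)] at hsL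
    have : (L / 2 + L / (2 * δ)) * (2 * s) = s * L * (1 + δ) / δ := by field_simp; ring
    rw [this, div_le_one hδ]
    exact hsL
  have := mul_le_mul_of_nonneg_right hcoef (sq_nonneg ‖p‖)
  have e2 : 1 / (2 * s) * ‖p‖ ^ 2 = ‖p‖ ^ 2 / (2 * s) := by ring
  rw [e]
  linarith

theorem ConvexOn.le_of_mapClusterPt_of_tendsto_gradient (hf : ConvexOn ℝ Set.univ f)
    (hg : ∀ u, HasGradientAt f (g u) u) (hLip : ∀ u v, ‖g u - g v‖ ≤ L * ‖u - v‖) {z : ℕ → E}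
    (hz : Tendsto (fun k => ‖g (z k)‖) atTop (𝓝 0)) {q : E} (hq : MapClusterPt q atTop z)
    (u : E) : f q ≤ f u := by
  have hcont : Continuous g :=
    (LipschitzWith.of_dist_le' fun u v => by simpa [dist_eq_norm] using hLip u v).continuous
  obtain ⟨ψ, hψ, hqψ⟩ := hq.tendsto_subseq
  have h0 : ‖g q‖ = 0 :=
    tendsto_nhds_unique ((hcont.tendsto q).comp hqψ).norm (hz.comp hψ.tendsto_atTop)
  simpa [norm_eq_zero.1 h0] using hf.add_inner_gradient_le (hg q) u

theorem ConvexOn.tendsto_min_of_tendsto_gradient [ProperSpace E] (hf : ConvexOn ℝ Set.univ f)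
    (hg : ∀ u, HasGradientAt f (g u) u)
    (hLip : ∀ u v, ‖g u - g v‖ ≤ L * ‖u - v‖) {z w : ℕ → E}
    (hz : Tendsto (fun k => ‖g (z k)‖) atTop (𝓝 0)) {θ : E} (hθ : ∀ u, f θ ≤ f u) {M : ℝ}
    (hM : ∀ k, ‖z k‖ ≤ M) {l : ℝ} (hfz : Tendsto (fun k => f (z k)) atTop (𝓝 l))
    (hw : Tendsto (fun k => ‖w k - z k‖) atTop (𝓝 0)) :
    Tendsto (fun k => f (w k)) atTop (𝓝 (f θ)) := by
  obtain ⟨q, -, ψ, hψ, hqψ⟩ := (isCompact_closedBall (0 : E) M).tendsto_subseq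
    (x := z) fun k => by simpa using hM k
  have hq : f q = f θ := le_antisymm
    (hf.le_of_mapClusterPt_of_tendsto_gradient hg hLip hz
      (hqψ.mapClusterPt.of_comp hψ.tendsto_atTop) θ) (hθ q)
  have hl : l = f θ := by
    rw [← hq]
    exact tendsto_nhds_unique (hfz.comp hψ.tendsto_atTop) ((hg q).continuousAt.tendsto.comp hqψ)
  rw [hl] at hfz
  have hupper : Tendsto (fun k => f (z k) + ‖g (z k)‖ * ‖w k - z k‖
      + L / 2 * ‖w k - z k‖ ^ 2) atTop (𝓝 (f θ)) := by
    simpa using (hfz.add (hz.mul hw)).add ((hw.pow 2).const_mul (L / 2))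
  refine tendsto_of_tendsto_of_tendsto_of_le_of_le tendsto_const_nhds hupper
    (fun k => hθ _) fun k => ?_
  have h1 := le_quadratic_of_lipschitz_gradient hg hLip (z k) (w k)
  have h2 := real_inner_le_norm (g (z k)) (w k - z k)
  linarith

end SmoothConvex

section StackedVectors

variable {E : Type*} [NormedAddCommGroup E]

theorem norm_add_sq_le_two_mul (a b : E) : ‖a + b‖ ^ 2 ≤ 2 * ‖a‖ ^ 2 + 2 * ‖b‖ ^ 2 := by
  nlinarith [norm_add_le a b, norm_nonneg (a + b), sq_nonneg (‖a‖ - ‖b‖)]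

theorem sum_norm_add_sq_le {ι : Type*} [Fintype ι] (a b : ι → E) {η S : ℝ} (hη0 : 0 ≤ η)
    (hη1 : η < 1) (ha : ∑ i, ‖a i‖ ^ 2 ≤ η ^ 2 * S) (hS : 0 ≤ S) :
    ∑ i, ‖a i + b i‖ ^ 2 ≤ η * S + (∑ i, ‖b i‖ ^ 2) / (1 - η) := by
  have h (v : ι → E) : ‖WithLp.toLp 2 v‖ ^ 2 = ∑ i, ‖v i‖ ^ 2 := by
    simp [PiLp.norm_sq_eq_of_L2]
  have htri := norm_add_le (WithLp.toLp 2 a) (WithLp.toLp 2 b)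
  rw [← WithLp.toLp_add] at htri
  have hA : ‖WithLp.toLp 2 a‖ ≤ η * √S := by
    refine le_of_sq_le_sq ?_ (by positivity)
    rw [h, mul_pow, Real.sq_sqrt hS]
    exact ha
  have hsum := h (a + b)
  simp only [Pi.add_apply] at hsum
  rw [← hsum, ← h b]
  set N := ‖WithLp.toLp 2 b‖
  have hN : 0 ≤ N := norm_nonneg _
  have h1 : ‖WithLp.toLp 2 (a + b)‖ ^ 2 ≤ (η * √S + N) ^ 2 := by gcongr; linarith
  refine h1.trans ?_
  have hpos : 0 < 1 - η := by linarith
  have : η * S + N ^ 2 / (1 - η) - (η * √S + N) ^ 2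
      = η * ((1 - η) * √S - N) ^ 2 / (1 - η) := by
    have : S = √S ^ 2 := (Real.sq_sqrt hS).symm
    rw [this, Real.sqrt_sq (Real.sqrt_nonneg S)]
    field_simp
    ring
  have h2 : 0 ≤ η * ((1 - η) * √S - N) ^ 2 / (1 - η) := by positivity
  linarith

variable [InnerProductSpace ℝ E]

theorem norm_sum_smul_sq_le_s6 {ι : Type*} [Fintype ι] (a : ι → ℝ) (v : ι → E) :
    ‖∑ i, a i • v i‖ ^ 2 ≤ (∑ i, a i ^ 2) * ∑ i, ‖v i‖ ^ 2 := by
  calc ‖∑ i, a i • v i‖ ^ 2 ≤ (∑ i, |a i| * ‖v i‖) ^ 2 := by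
        gcongr
        exact (norm_sum_le _ _).trans_eq (by simp [norm_smul])
    _ ≤ (∑ i, |a i| ^ 2) * ∑ i, ‖v i‖ ^ 2 := Finset.sum_mul_sq_le_sq_mul_sq _ _ _
    _ = _ := by simp

theorem sum_norm_sub_mean_sq_le {m : ℕ} (v : Fin m → E) :
    ∑ i, ‖v i - (1 / (m : ℝ)) • ∑ j, v j‖ ^ 2 ≤ ∑ i, ‖v i‖ ^ 2 := by
  rcases Nat.eq_zero_or_pos m with rfl | hm
  · simp
  have hm' : (m : ℝ) ≠ 0 := by positivity
  set μ := (1 / (m : ℝ)) • ∑ j, v j with hμ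
  have hs : ∑ j, v j = (m : ℝ) • μ := by rw [hμ, smul_smul]; field_simp; simp
  have : ∑ i, ‖v i - μ‖ ^ 2 = ∑ i, ‖v i‖ ^ 2 - m * ‖μ‖ ^ 2 := by
    simp_rw [norm_sub_sq_real, Finset.sum_add_distrib, Finset.sum_sub_distrib, ← Finset.mul_sum,
      ← sum_inner, hs, inner_smul_left, real_inner_self_eq_norm_sq]
    simp
    ring
  rw [this]
  have : 0 ≤ (m : ℝ) * ‖μ‖ ^ 2 := by positivity
  linarith

theorem sum_norm_colStochastic_sq_le {m : ℕ} {B : Matrix (Fin m) (Fin m) ℝ}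
    (hB : ∀ i j, 0 ≤ B i j) (hcol : ∀ j, ∑ i, B i j = 1) (v : Fin m → E) :
    ∑ i, ‖∑ j, B i j • v j‖ ^ 2 ≤ m * ∑ j, ‖v j‖ ^ 2 := by
  calc ∑ i, ‖∑ j, B i j • v j‖ ^ 2 ≤ (∑ i, ‖∑ j, B i j • v j‖) ^ 2 :=
        Finset.sum_sq_le_sq_sum_of_nonneg fun _ _ => norm_nonneg _
    _ ≤ (∑ i, ∑ j, B i j * ‖v j‖) ^ 2 := by
        gcongr with i
        exact (norm_sum_le _ _).trans_eq (by simp [norm_smul, abs_of_nonneg (hB i _)])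
    _ = (∑ j, ‖v j‖) ^ 2 := by
        rw [Finset.sum_comm]
        simp_rw [← Finset.sum_mul, hcol, one_mul]
    _ ≤ _ := by simpa using sq_sum_le_card_mul_sum_sq (s := Finset.univ) (f := fun j => ‖v j‖)

end StackedVectors

section Mixing

variable {d m : ℕ}

theorem sum_norm_matrix_smul_sq_le (A : Matrix (Fin m) (Fin m) ℝ)
    (v : Fin m → EuclideanSpace ℝ (Fin d)) :
    ∑ i, ‖∑ j, A i j • v j‖ ^ 2 ≤ specNorm A ^ 2 * ∑ j, ‖v j‖ ^ 2 := by
  have hcoord (l : Fin d) :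
      ∑ i, (∑ j, A i j * v j l) ^ 2 ≤ specNorm A ^ 2 * ∑ j, v j l ^ 2 := by
    have h := (Matrix.toEuclideanCLM (𝕜 := ℝ) A).le_opNorm (WithLp.toLp 2 fun j => v j l)
    have h2 := pow_le_pow_left₀ (norm_nonneg _) h 2
    rw [mul_pow, Matrix.toEuclideanCLM_toLp, EuclideanSpace.norm_sq_eq,
      EuclideanSpace.norm_sq_eq] at h2
    simpa [Matrix.mulVec, dotProduct, specNorm] using h2
  simp_rw [EuclideanSpace.norm_sq_eq, Real.norm_eq_abs, sq_abs]
  rw [Finset.sum_comm, Finset.sum_comm (s := Finset.univ (α := Fin m)), Finset.mul_sum]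
  refine Finset.sum_le_sum fun l _ => ?_
  simpa using hcoord l

theorem sum_norm_mixing_sub_mean_sq_le (hm : 0 < m) {W : Matrix (Fin m) (Fin m) ℝ} {η : ℝ}
    (hWrow : ∀ i, ∑ j, W i j = 1) (hWcol : ∀ j, ∑ i, W i j = 1)
    (hη : η = specNorm (W - Matrix.of fun _ _ => (1 : ℝ) / m)) (hη1 : η < 1)
    {u u' p : Fin m → EuclideanSpace ℝ (Fin d)} (hu : ∀ i, u' i = (∑ j, W i j • u j) + p i) :
    ∑ i, ‖u' i - (1 / (m : ℝ)) • ∑ j, u' j‖ ^ 2 ≤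
      η * ∑ i, ‖u i - (1 / (m : ℝ)) • ∑ j, u j‖ ^ 2 +
        (∑ i, ‖p i - (1 / (m : ℝ)) • ∑ j, p j‖ ^ 2) / (1 - η) := by
  have hm' : (m : ℝ) ≠ 0 := by positivity
  have hη0 : 0 ≤ η := hη ▸ norm_nonneg _
  set μ := (1 / (m : ℝ)) • ∑ j, u j with hμ
  have hs : ∑ j, u j = (m : ℝ) • μ := by rw [hμ, smul_smul]; field_simp; simp
  have hsum : ∑ i, u' i = (∑ j, u j) + ∑ i, p i := by
    simp_rw [hu, Finset.sum_add_distrib]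
    rw [Finset.sum_comm]
    simp_rw [← Finset.sum_smul, hWcol, one_smul]
  set A : Matrix (Fin m) (Fin m) ℝ := W - Matrix.of fun _ _ => (1 : ℝ) / m with hAdef
  have hA (i : Fin m) : ∑ j, A i j • (u j - μ) = (∑ j, W i j • u j) - μ := by
    simp only [hAdef, Matrix.sub_apply, Matrix.of_apply, sub_smul, smul_sub, Finset.sum_sub_distrib,
      ← Finset.sum_smul, hWrow, ← Finset.smul_sum, hs]
    simp [smul_smul, hm']
  have key := sum_norm_add_sq_le
    (fun i => ∑ j, A i j • (u j - μ))
    (fun i => p i - (1 / (m : ℝ)) • ∑ j, p j) hη0 hη1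
    (by rw [hη]; exact sum_norm_matrix_smul_sq_le _ _)
    (Finset.sum_nonneg fun _ _ => sq_nonneg _)
  refine le_of_eq_of_le (Finset.sum_congr rfl fun i _ => ?_) key
  rw [hA, hsum, hu, smul_add, ← hμ]
  congr 2
  abel

end Mixing

section Sequences

theorem robbins_siegmund_s6 {V U a b : ℕ → ℝ} (hV : ∀ k, 0 ≤ V k) (hU : ∀ k, 0 ≤ U k)
    (ha : ∀ k, 0 ≤ a k) (hb : ∀ k, 0 ≤ b k) (hsa : Summable a) (hsb : Summable b)
    (hstep : ∀ k, V (k + 1) ≤ (1 + a k) * V k + b k - U k) :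
    Summable U ∧ ∃ l, Tendsto V atTop (𝓝 l) := by
  have hbound (k : ℕ) : V k ≤ Real.exp (∑ j ∈ Finset.range k, a j) *
      (V 0 + ∑ j ∈ Finset.range k, b j) := by
    induction k with
    | zero => simp
    | succ k ih =>
      rw [Finset.sum_range_succ, Finset.sum_range_succ, Real.exp_add]
      set S := ∑ j ∈ Finset.range k, a j
      have hS : 0 ≤ S := Finset.sum_nonneg fun j _ => ha j
      have h1 : 1 + a k ≤ Real.exp (a k) := by linarith [Real.add_one_le_exp (a k)]
      have h2 : (1 + a k) * V k ≤ Real.exp (a k) * (Real.exp S * (V 0 + ∑ j ∈ Finset.range k, b j)) :=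
        mul_le_mul h1 ih (hV k) (Real.exp_pos _).le
      have h3 : 1 ≤ Real.exp S * Real.exp (a k) := by
        rw [← Real.exp_add]; exact Real.one_le_exp (add_nonneg hS (ha k))
      nlinarith [hstep k, hU k, mul_le_mul_of_nonneg_right h3 (hb k)]
  obtain ⟨M, hM⟩ : ∃ M, ∀ k, V k ≤ M := by
    refine ⟨Real.exp (∑' j, a j) * (V 0 + ∑' j, b j), fun k => (hbound k).trans ?_⟩
    have := hsa.sum_le_tsum (Finset.range k) fun j _ => ha j
    have := hsb.sum_le_tsum (Finset.range k) fun j _ => hb j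
    have : 0 ≤ V 0 + ∑ j ∈ Finset.range k, b j :=
      add_nonneg (hV 0) (Finset.sum_nonneg fun j _ => hb j)
    gcongr
  have hse : Summable fun k => a k * M + b k := (hsa.mul_right M).add hsb
  have hstep' (k : ℕ) : V (k + 1) + U k ≤ V k + (a k * M + b k) := by
    nlinarith [hstep k, mul_le_mul_of_nonneg_left (hM k) (ha k)]
  have htel (k : ℕ) : V k + ∑ j ∈ Finset.range k, U j ≤
      V 0 + ∑ j ∈ Finset.range k, (a j * M + b j) := by
    induction k with
    | zero => simp
    | succ k ih => rw [Finset.sum_range_succ, Finset.sum_range_succ]; linarith [hstep' k]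
  have hM0 : 0 ≤ M := (hV 0).trans (hM 0)
  have hsU : Summable U := by
    refine summable_of_sum_range_le (c := V 0 + ∑' j, (a j * M + b j)) hU fun k => ?_
    have := hse.sum_le_tsum (Finset.range k) fun j _ => add_nonneg (mul_nonneg (ha j) hM0) (hb j)
    linarith [htel k, hV k]
  refine ⟨hsU, ?_⟩
  have hanti : Antitone fun k => V k + ∑ j ∈ Finset.range k, U j
      - ∑ j ∈ Finset.range k, (a j * M + b j) := by
    refine antitone_nat_of_succ_le fun k => ?_
    simp only [Finset.sum_range_succ]
    linarith [hstep' k]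
  have hbdd : BddBelow (Set.range fun k => V k + ∑ j ∈ Finset.range k, U j
      - ∑ j ∈ Finset.range k, (a j * M + b j)) := by
    refine ⟨-∑' j, (a j * M + b j), ?_⟩
    rintro _ ⟨k, rfl⟩
    have := hse.sum_le_tsum (Finset.range k) fun j _ => add_nonneg (mul_nonneg (ha j) hM0) (hb j)
    have : 0 ≤ ∑ j ∈ Finset.range k, U j := Finset.sum_nonneg fun j _ => hU j
    simp only
    linarith [hV k]
  refine ⟨_, (((tendsto_atTop_ciInf hanti hbdd).add hse.hasSum.tendsto_sum_nat).sub
    hsU.hasSum.tendsto_sum_nat).congr fun k => ?_⟩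
  ring

end Sequences

theorem exists_lyapunov_weights {η c δ L : ℝ} (hη0 : 0 ≤ η) (hη1 : η < 1)
    (hc : c < 1) (hδ : δ ∈ Set.Ioo (0 : ℝ) 1) (hL : 0 < L) :
    ∃ α β κ : ℝ, 0 < α ∧ 0 < β ∧ 0 < κ ∧
      L / 2 * (1 - η) + α * η + β * ((1 - η) ^ 2 * (1 - c) * (1 - δ)) ≤ α - κ ∧
      α / (1 - η) + β * c ≤ β - κ ∧
      β * ((1 - η) ^ 2 * (1 - c) * (1 - δ)) + κ ≤ L / (2 * δ) := by
  obtain ⟨hδ0, hδ1⟩ := hδ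
  have h1 : 0 < 1 - η := by linarith
  have h2 : 0 < 1 - c := by linarith
  have h3 : 0 < 1 - δ := by linarith
  set α := L / (2 * δ) * (1 + δ / 2) with hα
  set ε := δ ^ 2 / (4 * (1 - δ)) with hε
  set β := α * (1 + ε) / ((1 - η) * (1 - c)) with hβ
  have hα0 : 0 < α := by positivity
  have hε0 : 0 < ε := by positivity
  have hβ0 : 0 < β := by positivity
  have e1 : β * ((1 - η) ^ 2 * (1 - c) * (1 - δ)) = (1 - η) * (α * (1 - δ + δ ^ 2 / 4)) := by
    rw [hβ, hε]; field_simp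
  have e2 : β * (1 - c) = α * (1 + ε) / (1 - η) := by rw [hβ]; field_simp
  have e3 : α * (1 - δ + δ ^ 2 / 4)
      = L / (2 * δ) - L / (2 * δ) * (δ / 2 + δ ^ 2 / 4 - δ ^ 3 / 8) := by
    rw [hα]; field_simp; ring
  have e4 : α * (δ - δ ^ 2 / 4) = L / 2 + L / 2 * (δ / 4 - δ ^ 2 / 8) := by
    rw [hα]; field_simp; ring
  have p1 : 0 < δ / 4 - δ ^ 2 / 8 := by nlinarith
  have p2 : 0 < δ / 2 + δ ^ 2 / 4 - δ ^ 3 / 8 := by nlinarith [sq_nonneg δ, mul_pos hδ0 hδ0]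
  set κ₁ := (1 - η) * (L / 2 * (δ / 4 - δ ^ 2 / 8)) with hκ₁
  set κ₂ := α * ε / (1 - η) with hκ₂
  set κ₃ := L / (2 * δ) * (δ / 2 + δ ^ 2 / 4 - δ ^ 3 / 8) with hκ₃
  have q1 : 0 < κ₁ := by positivity
  have q2 : 0 < κ₂ := by positivity
  have q3 : 0 < κ₃ := by positivity
  refine ⟨α, β, min κ₁ (min κ₂ κ₃), hα0, hβ0, by simp [q1, q2, q3], ?_, ?_, ?_⟩
  · have : min κ₁ (min κ₂ κ₃) ≤ κ₁ := min_le_left _ _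
    rw [e1]
    have e5 : α * (1 - δ + δ ^ 2 / 4) = α - (L / 2 + L / 2 * (δ / 4 - δ ^ 2 / 8)) := by
      rw [← e4]; ring
    have e6 : L / 2 * (1 - η) + α * η + (1 - η) * (α * (1 - δ + δ ^ 2 / 4)) = α - κ₁ := by
      rw [e5, hκ₁]; ring
    linarith
  · have : min κ₁ (min κ₂ κ₃) ≤ κ₂ := (min_le_right _ _).trans (min_le_left _ _)
    have : α * (1 + ε) / (1 - η) = α / (1 - η) + κ₂ := by rw [hκ₂]; ring
    linarith
  · have : min κ₁ (min κ₂ κ₃) ≤ κ₃ := (min_le_right _ _).trans (min_le_right _ _)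
    rw [e1]
    have : 0 ≤ α * (1 - δ + δ ^ 2 / 4) := by nlinarith [sq_nonneg δ, mul_pos hα0 h3]
    nlinarith

section Objective

variable {E : Type*} [NormedAddCommGroup E] [InnerProductSpace ℝ E] {m : ℕ}

theorem norm_weighted_mean_sub_sq_le (hm : 0 < m) {l : Fin m → ℝ} {s M : ℝ}
    (hl0 : ∀ i, 0 ≤ l i) (hlM : ∀ i, l i ≤ M) (g w : Fin m → E) :
    ‖(1 / (m : ℝ)) • (∑ i, l i • g i) - s • ((1 / (m : ℝ)) • ∑ i, w i)‖ ^ 2 ≤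
      2 * M ^ 2 / m * (∑ i, ‖g i - w i‖ ^ 2)
        + 2 * (∑ i, (l i - s) ^ 2) * ∑ i, ‖w i‖ ^ 2 := by
  have hm1 : (1 : ℝ) ≤ m := by exact_mod_cast hm
  have hsplit : (1 / (m : ℝ)) • (∑ i, l i • g i) - s • ((1 / (m : ℝ)) • ∑ i, w i)
      = (1 / (m : ℝ)) • ((∑ i, l i • (g i - w i)) + ∑ i, (l i - s) • w i) := by
    simp only [smul_sub, sub_smul, Finset.sum_sub_distrib, ← Finset.smul_sum]
    module
  have hsq : ∑ i, l i ^ 2 ≤ m * M ^ 2 := by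
    calc ∑ i, l i ^ 2 ≤ ∑ _i : Fin m, M ^ 2 :=
          Finset.sum_le_sum fun i _ => pow_le_pow_left₀ (hl0 i) (hlM i) 2
      _ = _ := by simp
  have h1 := norm_sum_smul_sq_le_s6 l fun i => g i - w i
  have h2 := norm_sum_smul_sq_le_s6 (fun i => l i - s) w
  have h3 := norm_add_sq_le_two_mul (∑ i, l i • (g i - w i)) (∑ i, (l i - s) • w i)
  have hP : 0 ≤ ∑ i, ‖g i - w i‖ ^ 2 := Finset.sum_nonneg fun _ _ => sq_nonneg _
  have hG : 0 ≤ ∑ i, ‖w i‖ ^ 2 := Finset.sum_nonneg fun _ _ => sq_nonneg _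
  have hD : 0 ≤ ∑ i, (l i - s) ^ 2 := Finset.sum_nonneg fun _ _ => sq_nonneg _
  have h4 := mul_le_mul_of_nonneg_right hsq hP
  rw [hsplit, norm_smul, mul_pow, Real.norm_of_nonneg (by positivity), div_pow, one_pow,
    one_div_mul_eq_div, div_le_iff₀ (by positivity)]
  have e : 2 * M ^ 2 / m * (∑ i, ‖g i - w i‖ ^ 2) * (m : ℝ) ^ 2
      = 2 * (m * M ^ 2 * ∑ i, ‖g i - w i‖ ^ 2) := by field_simp
  have h5 : (∑ i, (l i - s) ^ 2) * (∑ i, ‖w i‖ ^ 2) ≤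
      (∑ i, (l i - s) ^ 2) * (∑ i, ‖w i‖ ^ 2) * (m : ℝ) ^ 2 :=
    le_mul_of_one_le_right (by positivity) (one_le_pow₀ hm1)
  linarith

theorem norm_mean_sub_mean_le (hm : 0 < m) {g : Fin m → E → E} {L : ℝ}
    (hLip : ∀ i u v, ‖g i u - g i v‖ ≤ L * ‖u - v‖) (u v : E) :
    ‖(1 / (m : ℝ)) • ∑ i, g i u - (1 / (m : ℝ)) • ∑ i, g i v‖ ≤ L * ‖u - v‖ := by
  rw [← smul_sub, ← Finset.sum_sub_distrib, norm_smul, Real.norm_of_nonneg (by positivity),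
    one_div_mul_eq_div, div_le_iff₀ (by positivity)]
  calc ‖∑ i, (g i u - g i v)‖ ≤ ∑ _i : Fin m, L * ‖u - v‖ :=
        (norm_sum_le _ _).trans (Finset.sum_le_sum fun i _ => hLip i u v)
    _ = _ := by simp [mul_comm]

theorem objective_step_le [CompleteSpace E] (hm : 0 < m) {F : E → ℝ} {g : Fin m → E → E}
    {L η δ : ℝ} (hL : 0 < L) (hδ : 0 < δ) (hη1 : η < 1)
    (hF : ∀ u, HasGradientAt F ((1 / (m : ℝ)) • ∑ i, g i u) u)
    (hLip : ∀ i u v, ‖g i u - g i v‖ ≤ L * ‖u - v‖) {l : Fin m → ℝ} {s M : ℝ}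
    (hl0 : ∀ i, 0 ≤ l i) (hlM : ∀ i, l i ≤ M) (hs : s = (1 / (m : ℝ)) * ∑ i, l i)
    (hM : 2 * L / (m * s) * M ^ 2 ≤ 1 - η) (hsL : s * L ≤ δ / (1 + δ))
    {u p : E} {x : Fin m → E} (hp : p = (1 / (m : ℝ)) • ∑ i, l i • g i (x i)) :
    F (u - p) ≤ F u - s / 2 * ‖(1 / (m : ℝ)) • ∑ i, g i u‖ ^ 2 - L / (2 * δ) * ‖p‖ ^ 2
      + L / 2 * (1 - η) * (∑ i, ‖x i - u‖ ^ 2)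
      + (∑ i, (l i - s) ^ 2) / s * ∑ i, ‖g i u‖ ^ 2 := by
  have hm0 : (0 : ℝ) < m := by exact_mod_cast hm
  have hX : 0 ≤ ∑ i, ‖x i - u‖ ^ 2 := Finset.sum_nonneg fun _ _ => sq_nonneg _
  have hs0 : 0 ≤ s := hs ▸ mul_nonneg (by positivity) (Finset.sum_nonneg fun i _ => hl0 i)
  rcases hs0.eq_or_lt with h0 | hspos
  · have hz : ∑ i, l i = 0 := by
      rw [← h0] at hs
      simpa [hm0.ne'] using hs.symm
    have hli (i : Fin m) : l i = 0 :=
      (Finset.sum_eq_zero_iff_of_nonneg fun i _ => hl0 i).1 hz i (Finset.mem_univ i)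
    have hp0 : p = 0 := by simp [hp, hli]
    have : 0 ≤ L / 2 * (1 - η) * (∑ i, ‖x i - u‖ ^ 2) :=
      mul_nonneg (mul_nonneg (by positivity) (by linarith)) hX
    simpa [hp0, ← h0] using this
  · have h1 := inexact_gradient_step_le hF (norm_mean_sub_mean_le hm hLip) hspos hδ hsL u p
    have h2 := norm_weighted_mean_sub_sq_le (s := s) hm hl0 hlM (fun i => g i (x i))
      (fun i => g i u)
    rw [← hp] at h2
    have h3 : ∑ i, ‖g i (x i) - g i u‖ ^ 2 ≤ L ^ 2 * ∑ i, ‖x i - u‖ ^ 2 := by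
      rw [Finset.mul_sum]
      refine Finset.sum_le_sum fun i _ => ?_
      rw [← mul_pow]
      exact pow_le_pow_left₀ (norm_nonneg _) (hLip i _ _) 2
    have h4 : ‖p - s • (1 / (m : ℝ)) • ∑ i, g i u‖ ^ 2 / (2 * s) ≤
        L / 2 * (1 - η) * (∑ i, ‖x i - u‖ ^ 2)
          + (∑ i, (l i - s) ^ 2) / s * ∑ i, ‖g i u‖ ^ 2 := by
      calc _ ≤ (2 * M ^ 2 / m * (L ^ 2 * ∑ i, ‖x i - u‖ ^ 2)
              + 2 * (∑ i, (l i - s) ^ 2) * ∑ i, ‖g i u‖ ^ 2) / (2 * s) := by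
            gcongr
            exact h2.trans (by gcongr)
        _ = L / 2 * (2 * L / (m * s) * M ^ 2) * (∑ i, ‖x i - u‖ ^ 2)
              + (∑ i, (l i - s) ^ 2) / s * ∑ i, ‖g i u‖ ^ 2 := by
            field_simp
        _ ≤ _ := by gcongr
    linarith

theorem sum_norm_gradient_sq_le [CompleteSpace E] (hm : 0 < m) {f : Fin m → E → ℝ} {F : E → ℝ}
    {g : Fin m → E → E} {L : ℝ} (hL : 0 < L) (hconv : ∀ i, ConvexOn ℝ Set.univ (f i))
    (hg : ∀ i u, HasGradientAt (f i) (g i u) u)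
    (hLip : ∀ i u v, ‖g i u - g i v‖ ≤ L * ‖u - v‖)
    (hF : ∀ u, F u = (1 / (m : ℝ)) * ∑ i, f i u) {z : E} (hz : ∑ i, g i z = 0) (u : E) :
    ∑ i, ‖g i u‖ ^ 2 ≤ 4 * L * m * (F u - F z) + 2 * ∑ i, ‖g i z‖ ^ 2 := by
  have hm0 : (m : ℝ) ≠ 0 := by positivity
  have h (i : Fin m) : ‖g i u‖ ^ 2 ≤
      4 * L * (f i u - f i z - inner ℝ (g i z) (u - z)) + 2 * ‖g i z‖ ^ 2 := by
    have h1 := (hconv i).norm_gradient_sub_sq_le hL (hg i) (hLip i) u z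
    have h2 := norm_add_sq_le_two_mul (g i u - g i z) (g i z)
    rw [sub_add_cancel] at h2
    linarith
  refine (Finset.sum_le_sum fun i _ => h i).trans_eq ?_
  rw [Finset.sum_add_distrib, ← Finset.mul_sum, ← Finset.mul_sum, Finset.sum_sub_distrib,
    Finset.sum_sub_distrib, ← sum_inner, hz, inner_zero_left, hF, hF]
  field_simp
  ring

theorem sum_norm_gradient_increment_sq_le {l l' : EuclideanSpace ℝ (Fin m)} {g : Fin m → E → E}
    {L : ℝ} (hLip : ∀ i u v, ‖g i u - g i v‖ ≤ L * ‖u - v‖) (x x' : Fin m → E) (u : E) :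
    ∑ i, ‖l' i • g i (x' i) - l i • g i (x i)‖ ^ 2 ≤
      2 * (‖l'‖ ^ 2 * L ^ 2 * ∑ i, ‖x' i - x i‖ ^ 2)
        + 2 * (‖l' - l‖ ^ 2 *
          (2 * L ^ 2 * (∑ i, ‖x i - u‖ ^ 2) + 2 * ∑ i, ‖g i u‖ ^ 2)) := by
  have hcoord (v : EuclideanSpace ℝ (Fin m)) (i : Fin m) : v i ^ 2 ≤ ‖v‖ ^ 2 := by
    simpa using pow_le_pow_left₀ (norm_nonneg _) (PiLp.norm_apply_le v i) 2
  have hsq (i : Fin m) (a b : E) : ‖g i a - g i b‖ ^ 2 ≤ L ^ 2 * ‖a - b‖ ^ 2 := by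
    rw [← mul_pow]
    exact pow_le_pow_left₀ (norm_nonneg _) (hLip i a b) 2
  simp only [Finset.mul_sum, ← Finset.sum_add_distrib]
  refine Finset.sum_le_sum fun i _ => ?_
  have h1 := norm_add_sq_le_two_mul (l' i • (g i (x' i) - g i (x i))) ((l' - l) i • g i (x i))
  have h2 := norm_add_sq_le_two_mul (g i (x i) - g i u) (g i u)
  have e : l' i • (g i (x' i) - g i (x i)) + (l' - l) i • g i (x i)
      = l' i • g i (x' i) - l i • g i (x i) := by
    rw [PiLp.sub_apply]; module
  rw [e, norm_smul, norm_smul, mul_pow, mul_pow, Real.norm_eq_abs, Real.norm_eq_abs, sq_abs,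
    sq_abs] at h1
  rw [sub_add_cancel] at h2
  have h3 : l' i ^ 2 * ‖g i (x' i) - g i (x i)‖ ^ 2 ≤
      ‖l'‖ ^ 2 * (L ^ 2 * ‖x' i - x i‖ ^ 2) :=
    mul_le_mul (hcoord l' i) (hsq i _ _) (sq_nonneg _) (sq_nonneg _)
  have h4 : (l' - l) i ^ 2 * ‖g i (x i)‖ ^ 2 ≤
      ‖l' - l‖ ^ 2 * (2 * (L ^ 2 * ‖x i - u‖ ^ 2) + 2 * ‖g i u‖ ^ 2) :=
    mul_le_mul (hcoord _ i) (h2.trans (by linarith [hsq i (x i) u])) (sq_nonneg _) (sq_nonneg _)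
  linarith

end Objective

theorem sum_norm_step_sq_le {d m : ℕ} {W : Matrix (Fin m) (Fin m) ℝ}
    (hWrow : ∀ i, ∑ j, W i j = 1) {x x' y : Fin m → EuclideanSpace ℝ (Fin d)}
    (hx : ∀ i, x' i = (∑ j, W i j • x j) - y i) (μ ν : EuclideanSpace ℝ (Fin d)) :
    ∑ i, ‖x' i - x i‖ ^ 2 ≤ 3 * (specNorm (W - 1) ^ 2 * (∑ i, ‖x i - μ‖ ^ 2)
      + (∑ i, ‖y i - ν‖ ^ 2) + m * ‖ν‖ ^ 2) := by
  have hsplit (i : Fin m) :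
      x' i - x i = (∑ j, (W - 1) i j • (x j - μ)) - (y i - ν) - ν := by
    simp only [Matrix.sub_apply, Matrix.one_apply, sub_smul, smul_sub, Finset.sum_sub_distrib,
      ← Finset.sum_smul, hWrow, hx]
    simp
    abel
  have h3 (a b c : EuclideanSpace ℝ (Fin d)) :
      ‖a - b - c‖ ^ 2 ≤ 3 * (‖a‖ ^ 2 + ‖b‖ ^ 2 + ‖c‖ ^ 2) := by
    have h1 : ‖a - b - c‖ ≤ ‖a‖ + ‖b‖ + ‖c‖ := by
      linarith [norm_sub_le (a - b) c, norm_sub_le a b]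
    nlinarith [norm_nonneg (a - b - c), sq_nonneg (‖a‖ - ‖b‖), sq_nonneg (‖b‖ - ‖c‖),
      sq_nonneg (‖a‖ - ‖c‖)]
  calc ∑ i, ‖x' i - x i‖ ^ 2
      ≤ ∑ i, 3 * (‖∑ j, (W - 1) i j • (x j - μ)‖ ^ 2 + ‖y i - ν‖ ^ 2 + ‖ν‖ ^ 2) :=
        Finset.sum_le_sum fun i _ => by rw [hsplit]; exact h3 _ _ _
    _ = 3 * ((∑ i, ‖∑ j, (W - 1) i j • (x j - μ)‖ ^ 2) + (∑ i, ‖y i - ν‖ ^ 2)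
          + m * ‖ν‖ ^ 2) := by
        rw [← Finset.mul_sum, Finset.sum_add_distrib, Finset.sum_add_distrib]
        simp
    _ ≤ _ := by
        gcongr
        exact sum_norm_matrix_smul_sq_le _ _

theorem lyapunov_step_le {m L η c δ r ρ Δ h s α β κ e e' P P' Q Q' R N G G₀ S : ℝ}
    (hm : 1 ≤ m) (hL : 0 < L) (hη1 : η < 1) (hα : 0 < α) (hβ : 0 < β)
    (hρ : 0 ≤ ρ) (hΔ : 0 ≤ Δ) (hh : 0 ≤ h) (he : 0 ≤ e) (hP0 : 0 ≤ P) (hQ0 : 0 ≤ Q)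
    (hR0 : 0 ≤ R)
    (hw₁ : L / 2 * (1 - η) + α * η + β * ((1 - η) ^ 2 * (1 - c) * (1 - δ)) ≤ α - κ)
    (hw₂ : α / (1 - η) + β * c ≤ β - κ)
    (hw₃ : β * ((1 - η) ^ 2 * (1 - c) * (1 - δ)) + κ ≤ L / (2 * δ))
    (hc₁ : η + 6 * m ^ 2 * L ^ 2 / (1 - η) * ρ ≤ c)
    (hc₂ : max (m ^ 3 * r ^ 2) (m ^ 2) * 6 * L ^ 2 * ρ ≤ (1 - η) ^ 3 * (1 - c) * (1 - δ))
    (hstep : e' ≤ e - s / 2 * N - L / (2 * δ) * R + L / 2 * (1 - η) * P + h * G)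
    (hP : P' ≤ η * P + Q / (1 - η)) (hQ : Q' ≤ η * Q + m * S / (1 - η))
    (hS : S ≤ 2 * (ρ * L ^ 2 * (3 * (r ^ 2 * P + Q + m * R)))
      + 2 * (Δ * (2 * L ^ 2 * P + 2 * G)))
    (hG : G ≤ 4 * L * m * e + 2 * G₀) :
    e' + α * P' + β * Q' ≤
      (1 + (h * (4 * L * m) + Δ * (4 * m * β / (1 - η) * (L ^ 2 / α + 4 * L * m))))
          * (e + α * P + β * Q)
        + (h * (2 * G₀) + Δ * (4 * m * β / (1 - η) * (2 * G₀)))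
        - (s / 2 * N + κ * (P + Q + R)) := by
  have h1 : 0 < 1 - η := by linarith
  set Z := (1 - η) ^ 2 * (1 - c) * (1 - δ) with hZ
  set t := 6 * m * L ^ 2 * ρ / (1 - η) with ht
  set D := Δ * (4 * m * β / (1 - η)) with hD
  have ht0 : 0 ≤ t := by positivity
  have hD0 : 0 ≤ D := by positivity
  have hZ3 : (1 - η) ^ 3 * (1 - c) * (1 - δ) = Z * (1 - η) := by rw [hZ]; ring
  rw [hZ3] at hc₂
  have hmax (w : ℝ) (hw : w ≤ max (m ^ 3 * r ^ 2) (m ^ 2)) : w * 6 * L ^ 2 * ρ / (1 - η) ≤ Z := by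
    rw [div_le_iff₀ h1]
    exact le_trans (by gcongr) hc₂
  have htm : t * m ≤ Z := by
    refine le_of_eq_of_le ?_ (hmax (m ^ 2) (le_max_right _ _))
    rw [ht]; ring
  have htr : t * r ^ 2 ≤ Z := by
    refine le_of_eq_of_le ?_ (hmax (m * r ^ 2) (le_trans ?_ (le_max_left _ _)))
    · rw [ht]; ring
    · gcongr
      exact le_self_pow₀ hm (by norm_num)
  have htc : η + t ≤ c := by
    refine le_trans ?_ hc₁
    have : t ≤ t * m := le_mul_of_one_le_right ht0 hm
    have : t * m = 6 * m ^ 2 * L ^ 2 / (1 - η) * ρ := by rw [ht]; ring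
    linarith
  have hQ' : β * Q' ≤ β * (η * Q + t * (r ^ 2 * P + Q + m * R)) + D * (L ^ 2 * P + G) := by
    calc β * Q' ≤ β * (η * Q + m * (2 * (ρ * L ^ 2 * (3 * (r ^ 2 * P + Q + m * R)))
          + 2 * (Δ * (2 * L ^ 2 * P + 2 * G))) / (1 - η)) := by
          gcongr
          exact hQ.trans (by gcongr)
      _ = _ := by rw [ht, hD]; field_simp; ring
  have hP' : α * P' ≤ α * η * P + α / (1 - η) * Q := by
    refine (mul_le_mul_of_nonneg_left hP hα.le).trans_eq ?_
    ring
  have k₁ := mul_le_mul_of_nonneg_right (mul_le_mul_of_nonneg_left htr hβ.le) hP0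
  have k₂ := mul_le_mul_of_nonneg_right (mul_le_mul_of_nonneg_left htc hβ.le) hQ0
  have k₃ := mul_le_mul_of_nonneg_right (mul_le_mul_of_nonneg_left htm hβ.le) hR0
  have l₁ := mul_le_mul_of_nonneg_right hw₁ hP0
  have l₂ := mul_le_mul_of_nonneg_right hw₂ hQ0
  have l₃ := mul_le_mul_of_nonneg_right hw₃ hR0
  have herr : h * G + D * (L ^ 2 * P + G) ≤
      (h * (4 * L * m) + D * (L ^ 2 / α + 4 * L * m)) * (e + α * P + β * Q)
        + (h * (2 * G₀) + D * (2 * G₀)) := by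
    have g₁ := mul_le_mul_of_nonneg_left hG (add_nonneg hh hD0)
    have g₂ : D * (L ^ 2 * P) = D * (L ^ 2 / α) * (α * P) := by field_simp
    have g₃ : 0 ≤ (h * (4 * L * m) + D * (4 * L * m)) * (α * P + β * Q)
        + D * (L ^ 2 / α) * (e + β * Q) := by positivity
    linarith
  have hDa (w : ℝ) : Δ * (4 * m * β / (1 - η) * w) = D * w := by rw [hD]; ring
  rw [hDa, hDa]
  linarith

theorem tendsto_of_lyapunov_recursion {m L η c δ r G₀ : ℝ} (hm : 1 ≤ m) (hL : 0 < L)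
    (hη0 : 0 ≤ η) (hη1 : η < 1) (hc : c < 1) (hδ : δ ∈ Set.Ioo (0 : ℝ) 1) (hG₀ : 0 ≤ G₀)
    {ρ Δ h s e P Q R N G S : ℕ → ℝ} (hρ : ∀ k, 0 ≤ ρ k) (hΔ : ∀ k, 0 ≤ Δ k)
    (hh : ∀ k, 0 ≤ h k) (hs : ∀ k, 0 ≤ s k) (he : ∀ k, 0 ≤ e k) (hP0 : ∀ k, 0 ≤ P k)
    (hQ0 : ∀ k, 0 ≤ Q k) (hR0 : ∀ k, 0 ≤ R k) (hN0 : ∀ k, 0 ≤ N k)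
    (hhsum : Summable h) (hΔsum : Summable Δ)
    (hc₁ : ∀ k, η + 6 * m ^ 2 * L ^ 2 / (1 - η) * ρ k ≤ c)
    (hc₂ : ∀ k, max (m ^ 3 * r ^ 2) (m ^ 2) * 6 * L ^ 2 * ρ k ≤
      (1 - η) ^ 3 * (1 - c) * (1 - δ))
    (hstep : ∀ k, e (k + 1) ≤ e k - s k / 2 * N k - L / (2 * δ) * R k
      + L / 2 * (1 - η) * P k + h k * G k)
    (hP : ∀ k, P (k + 1) ≤ η * P k + Q k / (1 - η))
    (hQ : ∀ k, Q (k + 1) ≤ η * Q k + m * S k / (1 - η))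
    (hS : ∀ k, S k ≤ 2 * (ρ k * L ^ 2 * (3 * (r ^ 2 * P k + Q k + m * R k)))
      + 2 * (Δ k * (2 * L ^ 2 * P k + 2 * G k)))
    (hG : ∀ k, G k ≤ 4 * L * m * e k + 2 * G₀) :
    (∃ l, Tendsto e atTop (𝓝 l)) ∧ Tendsto P atTop (𝓝 0) ∧ Tendsto Q atTop (𝓝 0) ∧
      Tendsto R atTop (𝓝 0) ∧ Tendsto (fun k => s k / 2 * N k) atTop (𝓝 0) := by
  have hη' : 0 < 1 - η := by linarith
  obtain ⟨α, β, κ, hα, hβ, hκ, hw₁, hw₂, hw₃⟩ := exists_lyapunov_weights hη0 hη1 hc hδ hL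
  have hUs (k : ℕ) : 0 ≤ s k / 2 * N k := mul_nonneg (by linarith [hs k]) (hN0 k)
  have hUP (k : ℕ) : 0 ≤ κ * P k := mul_nonneg hκ.le (hP0 k)
  have hUQ (k : ℕ) : 0 ≤ κ * Q k := mul_nonneg hκ.le (hQ0 k)
  have hUR (k : ℕ) : 0 ≤ κ * R k := mul_nonneg hκ.le (hR0 k)
  have ha : 0 ≤ 4 * m * β / (1 - η) * (L ^ 2 / α + 4 * L * m) := by positivity
  have hb : 0 ≤ 4 * m * β / (1 - η) * (2 * G₀) := by positivity
  obtain ⟨hsumU, v, hv⟩ := robbins_siegmund_s6 (V := fun k => e k + α * P k + β * Q k)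
    (U := fun k => s k / 2 * N k + κ * (P k + Q k + R k))
    (a := fun k => h k * (4 * L * m) + Δ k * (4 * m * β / (1 - η) * (L ^ 2 / α + 4 * L * m)))
    (b := fun k => h k * (2 * G₀) + Δ k * (4 * m * β / (1 - η) * (2 * G₀)))
    (fun k => add_nonneg (add_nonneg (he k) (mul_nonneg hα.le (hP0 k)))
      (mul_nonneg hβ.le (hQ0 k)))
    (fun k => by linarith [hUs k, hUP k, hUQ k, hUR k])
    (fun k => add_nonneg (mul_nonneg (hh k) (by positivity)) (mul_nonneg (hΔ k) ha))
    (fun k => add_nonneg (mul_nonneg (hh k) (by positivity)) (mul_nonneg (hΔ k) hb))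
    ((hhsum.mul_right _).add (hΔsum.mul_right _)) ((hhsum.mul_right _).add (hΔsum.mul_right _))
    (fun k => lyapunov_step_le hm hL hη1 hα hβ (hρ k) (hΔ k) (hh k) (he k) (hP0 k) (hQ0 k)
      (hR0 k) hw₁ hw₂ hw₃ (hc₁ k) (hc₂ k) (hstep k) (hP k) (hQ k) (hS k) (hG k))
  have hU := hsumU.tendsto_atTop_zero
  have hsqueeze {a : ℕ → ℝ} (h0 : ∀ k, 0 ≤ κ * a k)
      (h1 : ∀ k, κ * a k ≤ s k / 2 * N k + κ * (P k + Q k + R k)) : Tendsto a atTop (𝓝 0) := by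
    have := (squeeze_zero h0 h1 hU).const_mul κ⁻¹
    simpa [inv_mul_cancel_left₀ hκ.ne'] using this
  have hPlim := hsqueeze hUP fun k => by linarith [hUs k, hUQ k, hUR k]
  have hQlim := hsqueeze hUQ fun k => by linarith [hUs k, hUP k, hUR k]
  have hRlim := hsqueeze hUR fun k => by linarith [hUs k, hUP k, hUQ k]
  refine ⟨⟨v, ?_⟩, hPlim, hQlim, hRlim,
    squeeze_zero hUs (fun k => by linarith [hUP k, hUQ k, hUR k]) hU⟩
  have := hv.sub ((hPlim.const_mul α).add (hQlim.const_mul β))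
  simp only [mul_zero, add_zero, sub_zero] at this
  refine this.congr fun k => ?_
  ring

/-- Theorem 3: convergence of PDG-NDS under non-diminishing uncoordinated stepsizes. -/
theorem stmt_6 {d m : ℕ} (hm : 0 < m)
    (W : Matrix (Fin m) (Fin m) ℝ)
    (hWnn : ∀ i j, 0 ≤ W i j)
    (hWrow : ∀ i, ∑ j, W i j = 1)
    (hWcol : ∀ j, ∑ i, W i j = 1)
    (η r : ℝ)
    (hηdef : η = specNorm (W - Matrix.of fun _ _ => (1 : ℝ) / m))
    (hη : η < 1)
    (hrdef : r = specNorm (W - 1))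
    (L : ℝ) (hL : 0 < L)
    (f : Fin m → EuclideanSpace ℝ (Fin d) → ℝ)
    (hconv : ∀ i, ConvexOn ℝ Set.univ (f i))
    (hdiff : ∀ i, Differentiable ℝ (f i))
    (hLip : ∀ i u v, ‖gradient (f i) u - gradient (f i) v‖ ≤ L * ‖u - v‖)
    (F : EuclideanSpace ℝ (Fin d) → ℝ)
    (hF : ∀ θ, F θ = (1 / (m : ℝ)) * ∑ i, f i θ)
    (θs : EuclideanSpace ℝ (Fin d)) (hθs : ∀ z, F θs ≤ F z)
    (B : ℕ → Matrix (Fin m) (Fin m) ℝ)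
    (hBnn : ∀ k i j, 0 ≤ B k i j)
    (hBcol : ∀ k j, ∑ i, B k i j = 1)
    (lam : ℕ → EuclideanSpace ℝ (Fin m))
    (hlam0 : ∀ k i, 0 ≤ lam k i)
    (lambar : ℕ → ℝ) (hlambar : ∀ k, lambar k = (1 / (m : ℝ)) * ∑ i, lam k i)
    (lammax : ℕ → ℝ) (hlammax : ∀ k, IsGreatest (Set.range fun i => lam k i) (lammax k))
    (x : ℕ → Fin m → EuclideanSpace ℝ (Fin d))
    (hinit : ∀ i, x 1 i = (∑ j, W i j • x 0 j) - lam 0 i • gradient (f i) (x 0 i))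
    (hupd : ∀ k i, x (k + 2) i =
      (2 : ℝ) • (∑ j, W i j • x (k + 1) j) - (∑ j, (W * W) i j • x k j)
        - (∑ j, (B k i j * lam (k + 1) j) • gradient (f j) (x (k + 1) j))
        + (∑ j, (B k i j * lam k j) • gradient (f j) (x k j)))
    (y : ℕ → Fin m → EuclideanSpace ℝ (Fin d))
    (hy : ∀ k i, y k i = (∑ j, W i j • x k j) - x (k + 1) i)
    (xbar : ℕ → EuclideanSpace ℝ (Fin d))
    (hxbar : ∀ k, xbar k = (1 / (m : ℝ)) • ∑ i, x k i)
    (ybar : ℕ → EuclideanSpace ℝ (Fin d))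
    (hybar : ∀ k, ybar k = (1 / (m : ℝ)) • ∑ i, y k i)
    (T : ℕ) (δ c : ℝ) (hδ : δ ∈ Set.Ioo (0 : ℝ) 1) (hc : c ∈ Set.Ioo (0 : ℝ) 1)
    (hdiv : Tendsto (fun n => ∑ k ∈ Finset.range n, lambar (T + k)) atTop atTop)
    (hsucc : Summable fun k => ‖lam (T + k + 1) - lam (T + k)‖ ^ 2)
    (hhet : Summable fun k =>
      ‖lam (T + k) - lambar (T + k) • onesE m‖ ^ 2 / lambar (T + k))
    (hcond1 : ∀ k, T ≤ k → 2 * L / (m * lambar k) * (lammax k) ^ 2 ≤ 1 - η)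
    (hcond2 : ∀ k, T ≤ k → lambar k * L ≤ δ / (1 + δ))
    (hcond3 : ∀ k, T ≤ k → η + 6 * m ^ 2 * L ^ 2 / (1 - η) * ‖lam (k + 1)‖ ^ 2 ≤ c)
    (hcond4 : ∀ k, T ≤ k →
      max ((m : ℝ) ^ 3 * r ^ 2) ((m : ℝ) ^ 2) * 6 * L ^ 2 * ‖lam (k + 1)‖ ^ 2 ≤
        (1 - η) ^ 3 * (1 - c) * (1 - δ)) :
    (∃ l, Tendsto (fun k => F (xbar k)) atTop (𝓝 l)) ∧
      Tendsto (fun k => ‖ybar k‖) atTop (𝓝 0) ∧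
      (∀ i, Tendsto (fun k => ‖x k i - xbar k‖) atTop (𝓝 0)) ∧
      (∀ i, Tendsto (fun k => ‖y k i - ybar k‖) atTop (𝓝 0)) ∧
      (∀ l, 0 < l → Tendsto lambar atTop (𝓝 l) →
        Tendsto (fun k => ‖gradient F (xbar k)‖) atTop (𝓝 0) ∧
          ((∃ M, ∀ k, ‖xbar k‖ ≤ M) →
            (∀ q, MapClusterPt q atTop xbar → ∀ z, F q ≤ F z) ∧
            ∀ i, Tendsto (fun k => F (x k i)) atTop (𝓝 (F θs)))) := by
  have hm0 : (m : ℝ) ≠ 0 := by positivity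
  have hm1 : (1 : ℝ) ≤ m := by exact_mod_cast hm
  have hη0 : 0 ≤ η := hηdef ▸ norm_nonneg _
  have hη' : 0 < 1 - η := by linarith
  set g : Fin m → EuclideanSpace ℝ (Fin d) → EuclideanSpace ℝ (Fin d) :=
    fun i => gradient (f i) with hgdef
  have hg (i : Fin m) (u : EuclideanSpace ℝ (Fin d)) : HasGradientAt (f i) (g i u) u :=
    (hdiff i u).hasGradientAt
  have hgF (u : EuclideanSpace ℝ (Fin d)) :
      HasGradientAt F ((1 / (m : ℝ)) • ∑ i, g i u) u := by
    rw [hasGradientAt_iff_hasFDerivAt, funext hF, map_smul, map_sum]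
    exact (HasFDerivAt.fun_sum fun i _ => (hg i u).hasFDerivAt).const_mul _
  have hFconv : ConvexOn ℝ Set.univ F := by
    rw [show F = (1 / (m : ℝ)) • ∑ i, f i from funext fun u => by simp [hF]]
    refine ConvexOn.smul (by positivity) ?_
    exact Finset.sum_induction f (ConvexOn ℝ Set.univ) (fun _ _ => ConvexOn.add)
      (convexOn_const 0 convex_univ) fun i _ => hconv i
  have hzero : ∑ i, g i θs = 0 := by
    have h := (IsLocalMin.hasFDerivAt_eq_zero (Eventually.of_forall hθs) (hgF θs).hasFDerivAt)
    rw [map_eq_zero_iff _ (InnerProductSpace.toDual ℝ _).injective] at h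
    simpa [hm0] using h
  have hFLip (u v : EuclideanSpace ℝ (Fin d)) :
      ‖(1 / (m : ℝ)) • ∑ i, g i u - (1 / (m : ℝ)) • ∑ i, g i v‖ ≤ L * ‖u - v‖ :=
    norm_mean_sub_mean_le hm hLip u v
  have hy0 (i : Fin m) : y 0 i = lam 0 i • g i (x 0 i) := by
    rw [hy, hinit]; abel
  have hyrec (k : ℕ) (i : Fin m) : y (k + 1) i = (∑ j, W i j • y k j) +
      ∑ j, B k i j • (lam (k + 1) j • g j (x (k + 1) j) - lam k j • g j (x k j)) := by
    have hWW : ∑ j, (W * W) i j • x k j = ∑ j, W i j • ∑ l, W j l • x k l := by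
      simp_rw [Matrix.mul_apply, Finset.sum_smul, Finset.smul_sum, smul_smul]
      exact Finset.sum_comm
    rw [hy, hupd, hWW]
    simp only [hy, smul_sub, Finset.sum_sub_distrib, smul_smul, hgdef]
    module
  have hxrec (k : ℕ) (i : Fin m) : x (k + 1) i = (∑ j, W i j • x k j) - y k i := by
    rw [hy]; abel
  have hcolsum (A : Matrix (Fin m) (Fin m) ℝ) (hA : ∀ j, ∑ i, A i j = 1)
      (v : Fin m → EuclideanSpace ℝ (Fin d)) : ∑ i, ∑ j, A i j • v j = ∑ j, v j := by
    rw [Finset.sum_comm]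
    simp_rw [← Finset.sum_smul, hA, one_smul]
  have hysum (k : ℕ) : ∑ i, y k i = ∑ i, lam k i • g i (x k i) := by
    induction k with
    | zero => simp_rw [hy0]
    | succ k ih =>
      simp_rw [hyrec, Finset.sum_add_distrib]
      rw [hcolsum W hWcol, hcolsum (B k) (hBcol k), Finset.sum_sub_distrib, ih]
      abel
  have hxbar_succ (k : ℕ) : xbar (k + 1) = xbar k - ybar k := by
    rw [hxbar, hxbar, hybar]
    simp_rw [hxrec, Finset.sum_sub_distrib]
    rw [hcolsum W hWcol, smul_sub]
  set e : ℕ → ℝ := fun k => F (xbar k) - F θs with hedef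
  set P : ℕ → ℝ := fun k => ∑ i, ‖x k i - xbar k‖ ^ 2 with hPdef
  set Q : ℕ → ℝ := fun k => ∑ i, ‖y k i - ybar k‖ ^ 2 with hQdef
  set R : ℕ → ℝ := fun k => ‖ybar k‖ ^ 2 with hRdef
  set N : ℕ → ℝ := fun k => ‖(1 / (m : ℝ)) • ∑ i, g i (xbar k)‖ ^ 2 with hNdef
  set S : ℕ → ℝ := fun k =>
    ∑ i, ‖lam (k + 1) i • g i (x (k + 1) i) - lam k i • g i (x k i)‖ ^ 2 with hSdef
  have he0 (k : ℕ) : 0 ≤ e k := sub_nonneg.2 (hθs _)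
  have hP0 (k : ℕ) : 0 ≤ P k := Finset.sum_nonneg fun _ _ => sq_nonneg _
  have hQ0 (k : ℕ) : 0 ≤ Q k := Finset.sum_nonneg fun _ _ => sq_nonneg _
  have hR0 (k : ℕ) : 0 ≤ R k := sq_nonneg _
  have hN0 (k : ℕ) : 0 ≤ N k := sq_nonneg _
  have hlb0 (k : ℕ) : 0 ≤ lambar k :=
    hlambar k ▸ mul_nonneg (by positivity) (Finset.sum_nonneg fun i _ => hlam0 k i)
  have hPstep (k : ℕ) : P (k + 1) ≤ η * P k + Q k / (1 - η) := by
    have h := sum_norm_mixing_sub_mean_sq_le hm hWrow hWcol hηdef hη (u := x k)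
      (u' := x (k + 1)) (p := fun i => -y k i) fun i => by rw [hxrec, sub_eq_add_neg]
    simp only [Finset.sum_neg_distrib, smul_neg, ← hxbar, ← hybar] at h
    simpa only [hPdef, hQdef, ← neg_sub', norm_neg] using h
  have hQstep (k : ℕ) : Q (k + 1) ≤ η * Q k + m * S k / (1 - η) := by
    have h := sum_norm_mixing_sub_mean_sq_le hm hWrow hWcol hηdef hη (hyrec k)
    simp only [← hybar] at h
    refine h.trans ?_
    gcongr
    exact (sum_norm_sub_mean_sq_le _).trans (sum_norm_colStochastic_sq_le (hBnn k) (hBcol k) _)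
  have hSstep (k : ℕ) : S k ≤
      2 * (‖lam (k + 1)‖ ^ 2 * L ^ 2 * (3 * (r ^ 2 * P k + Q k + m * R k)))
        + 2 * (‖lam (k + 1) - lam k‖ ^ 2 *
          (2 * L ^ 2 * P k + 2 * ∑ i, ‖g i (xbar k)‖ ^ 2)) := by
    refine (sum_norm_gradient_increment_sq_le hLip (x k) (x (k + 1)) (xbar k)).trans ?_
    have := sum_norm_step_sq_le hWrow (hxrec k) (xbar k) (ybar k)
    rw [← hrdef] at this
    gcongr
  have hFstep (k : ℕ) (hk : T ≤ k) : e (k + 1) ≤ e k - lambar k / 2 * N k - L / (2 * δ) * R k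
      + L / 2 * (1 - η) * P k
      + ‖lam k - lambar k • onesE m‖ ^ 2 / lambar k * ∑ i, ‖g i (xbar k)‖ ^ 2 := by
    have h := objective_step_le hm hL hδ.1 hη hgF hLip (hlam0 k)
      (fun i => (hlammax k).2 ⟨i, rfl⟩) (hlambar k) (hcond1 k hk) (hcond2 k hk)
      (u := xbar k) (p := ybar k) (x := x k) (by rw [hybar, hysum])
    have hnorm : ‖lam k - lambar k • onesE m‖ ^ 2 = ∑ i, (lam k i - lambar k) ^ 2 := by
      simp [EuclideanSpace.norm_sq_eq, onesE]
    rw [← hxbar_succ] at h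
    rw [hnorm]
    simp only [hedef, hNdef, hRdef, hPdef]
    linarith
  have hh0 (k : ℕ) : 0 ≤ ‖lam k - lambar k • onesE m‖ ^ 2 / lambar k :=
    div_nonneg (sq_nonneg _) (hlb0 k)
  have hTk (k : ℕ) : T ≤ T + k := Nat.le_add_right T k
  have hlims := tendsto_of_lyapunov_recursion hm1 hL hη0 hη hc.2 hδ
    (Finset.sum_nonneg fun i _ => sq_nonneg ‖g i θs‖)
    (ρ := fun k => ‖lam (T + k + 1)‖ ^ 2) (Δ := fun k => ‖lam (T + k + 1) - lam (T + k)‖ ^ 2)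
    (h := fun k => ‖lam (T + k) - lambar (T + k) • onesE m‖ ^ 2 / lambar (T + k))
    (s := fun k => lambar (T + k)) (e := fun k => e (T + k)) (P := fun k => P (T + k))
    (Q := fun k => Q (T + k)) (R := fun k => R (T + k)) (N := fun k => N (T + k))
    (G := fun k => ∑ i, ‖g i (xbar (T + k))‖ ^ 2) (S := fun k => S (T + k))
    (fun _ => sq_nonneg _) (fun _ => sq_nonneg _) (fun _ => hh0 _) (fun _ => hlb0 _)
    (fun _ => he0 _) (fun _ => hP0 _) (fun _ => hQ0 _) (fun _ => hR0 _) (fun _ => hN0 _)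
    hhet hsucc (fun k => hcond3 _ (hTk k)) (fun k => hcond4 _ (hTk k))
    (fun k => hFstep _ (hTk k)) (fun k => hPstep _) (fun k => hQstep _) (fun k => hSstep _)
    (fun k => sum_norm_gradient_sq_le hm hL hconv hg hLip hF hzero _)
  have hshift {a : ℕ → ℝ} {l : ℝ} (h : Tendsto (fun k => a (T + k)) atTop (𝓝 l)) :
      Tendsto a atTop (𝓝 l) := by
    simp_rw [add_comm T] at h
    exact (tendsto_add_atTop_iff_nat T).1 h
  obtain ⟨⟨v, hv⟩, hPlim, hQlim, hRlim, hsNlim⟩ := hlims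
  replace hPlim : Tendsto P atTop (𝓝 0) := hshift hPlim
  replace hQlim : Tendsto Q atTop (𝓝 0) := hshift hQlim
  replace hRlim : Tendsto R atTop (𝓝 0) := hshift hRlim
  replace hsNlim : Tendsto (fun k => lambar k / 2 * N k) atTop (𝓝 0) := hshift hsNlim
  have hnormlim {a : ℕ → EuclideanSpace ℝ (Fin d)} {b : ℕ → ℝ} (hb : Tendsto b atTop (𝓝 0))
      (hab : ∀ k, ‖a k‖ ^ 2 ≤ b k) : Tendsto (fun k => ‖a k‖) atTop (𝓝 0) := by
    have h := (squeeze_zero (fun k => sq_nonneg _) hab hb).sqrt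
    simpa using h
  have hxlim (i : Fin m) : Tendsto (fun k => ‖x k i - xbar k‖) atTop (𝓝 0) :=
    hnormlim hPlim fun k => Finset.single_le_sum
      (f := fun i => ‖x k i - xbar k‖ ^ 2) (fun _ _ => sq_nonneg _) (Finset.mem_univ i)
  have hFlim : Tendsto (fun k => F (xbar k)) atTop (𝓝 (v + F θs)) := by
    simpa [hedef] using (hshift (a := e) hv).add_const (F θs)
  refine ⟨⟨_, hFlim⟩, hnormlim hRlim fun k => le_rfl, hxlim, fun i => hnormlim hQlim fun k =>
    Finset.single_le_sum (f := fun i => ‖y k i - ybar k‖ ^ 2) (fun _ _ => sq_nonneg _)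
      (Finset.mem_univ i), fun l hl hlim => ?_⟩
  have hNlim : Tendsto N atTop (𝓝 0) := by
    have h2 := hsNlim.div (hlim.div_const 2) (by positivity)
    rw [zero_div] at h2
    refine h2.congr' ?_
    filter_upwards [hlim.eventually (lt_mem_nhds hl)] with k hk
    simp only [Pi.div_apply]
    field_simp
  have hgradF (u : EuclideanSpace ℝ (Fin d)) : gradient F u = (1 / (m : ℝ)) • ∑ i, g i u :=
    (hgF u).gradient
  have hgF' (u : EuclideanSpace ℝ (Fin d)) : HasGradientAt F (gradient F u) u := by
    rw [hgradF]; exact hgF u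
  have hFLip' (u v : EuclideanSpace ℝ (Fin d)) : ‖gradient F u - gradient F v‖ ≤ L * ‖u - v‖ := by
    rw [hgradF, hgradF]; exact hFLip u v
  have hgradlim : Tendsto (fun k => ‖gradient F (xbar k)‖) atTop (𝓝 0) :=
    hnormlim hNlim fun k => by rw [hgradF]
  exact ⟨hgradlim, fun ⟨M, hM⟩ => ⟨fun q hq => hFconv.le_of_mapClusterPt_of_tendsto_gradient hgF' hFLip'
    hgradlim hq, fun i => hFconv.tendsto_min_of_tendsto_gradient hgF' hFLip' hgradlim hθs hM hFlim
      (hxlim i)⟩⟩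
end
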